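/- arXiv:2401.13263 — 2 statements merged into one kernel-verified Lean document; each statement's English description precedes it below -/
import Mathlib

section
/- Let n ≥ 2 and let Ω ⊂ ℝⁿ be a bounded domain which is a local Sobolev–Poincaré imbedding domain of order n, i.e. there exist constants C ≥ 1, λ ≥ 1 and A > 0 such that for every locally Lipschitz function u : Ω → ℝ, every x ∈ Ω and every 0 < r < diam(Ω) with 0 < ∫_{B(x,λr)∩Ω} |∇u(y)|ⁿ dy < ∞, one has inf_{c∈ℝ} ∫_{B(x,r)∩Ω} exp( (A |u(y) − c| / (∫_{B(x,λr)∩Ω} |∇u(z)|ⁿ dz)^{1/n})^{n/(n−1)} ) dy ≤ C |B(x,r)|. Then Ω is an n-Poincaré domain. -/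
open Set Metric MeasureTheory ENNReal NNReal

noncomputable section

/-- Euclidean space `ℝⁿ`. -/
abbrev Euc (n : ℕ) : Type := EuclideanSpace ℝ (Fin n)

/-- `u` is locally Lipschitz on the set `Ω`. -/
def LocallyLipschitzOnSet {n : ℕ} (u : Euc n → ℝ) (Ω : Set (Euc n)) : Prop :=
  ∀ x ∈ Ω, ∃ K : ℝ≥0, ∃ s ∈ nhdsWithin x Ω, LipschitzOnWith K u s

/-- `x` and `y` are joined by a (continuous) curve lying in `S`. -/
def JoinedByCurveIn {n : ℕ} (S : Set (Euc n)) (x y : Euc n) : Prop :=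
  ∃ γ : ℝ → Euc n, ContinuousOn γ (Icc 0 1) ∧ γ 0 = x ∧ γ 1 = y ∧ MapsTo γ (Icc 0 1) S

/-- `γ` is parametrized by arclength on `[0, L]`. -/
def ArclengthOn {n : ℕ} (γ : ℝ → Euc n) (L : ℝ) : Prop :=
  ∀ s t : ℝ, 0 ≤ s → s ≤ t → t ≤ L → eVariationOn γ (Icc s t) = ENNReal.ofReal (t - s)

/-- `Ω` is an `ε₀`-uniform domain. -/
def IsUniformWith {n : ℕ} (Ω : Set (Euc n)) (ε₀ : ℝ) : Prop :=
  ∀ x ∈ Ω, ∀ y ∈ Ω, ∃ γ : ℝ → Euc n,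
    ContinuousOn γ (Icc 0 1) ∧ γ 0 = x ∧ γ 1 = y ∧ MapsTo γ (Icc 0 1) Ω ∧
    eVariationOn γ (Icc 0 1) ≤ ENNReal.ofReal (dist x y / ε₀) ∧
    ∀ t ∈ Icc (0:ℝ) 1,
      ε₀ * (dist x (γ t) * dist y (γ t)) / dist x y ≤ infDist (γ t) (frontier Ω)

/-- `Ω` is a uniform domain. -/
def IsUniformDomain {n : ℕ} (Ω : Set (Euc n)) : Prop :=
  ∃ ε₀ : ℝ, 0 < ε₀ ∧ ε₀ ≤ 1 ∧ IsUniformWith Ω ε₀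

/-- `Ω` is an `α`-cigar domain: any two points can be joined by a rectifiable
(arclength-parametrized) curve in `Ω` along which
`∫_γ dist(z, ∂Ω)^(α-1) |dz| ≤ C |x - y|^α`. -/
def IsCigarDomain {n : ℕ} (Ω : Set (Euc n)) (α : ℝ) : Prop :=
  ∃ C : ℝ, 0 < C ∧ ∀ x ∈ Ω, ∀ y ∈ Ω, ∃ L : ℝ, 0 ≤ L ∧ ∃ γ : ℝ → Euc n,
    γ 0 = x ∧ γ L = y ∧ MapsTo γ (Icc 0 L) Ω ∧ ArclengthOn γ L ∧
    (∫⁻ t in Icc (0:ℝ) L, ENNReal.ofReal (infDist (γ t) (frontier Ω) ^ (α - 1)) ∂volume)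
      ≤ ENNReal.ofReal (C * dist x y ^ α)

/-- `Ω` is a `c₀`-John domain. -/
def IsJohnDomain {n : ℕ} (Ω : Set (Euc n)) (c₀ : ℝ) : Prop :=
  ∃ x₀ ∈ Ω, ∀ x ∈ Ω, ∃ l : ℝ, 0 ≤ l ∧ ∃ γ : ℝ → Euc n,
    γ 0 = x ∧ γ l = x₀ ∧ MapsTo γ (Icc 0 l) Ω ∧ ArclengthOn γ l ∧
    ∀ t ∈ Icc (0:ℝ) l, c₀ * t ≤ infDist (γ t) (frontier Ω)

/-- `Ω` has the `C`-slice property with respect to `x₀`. -/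
def HasSliceProperty {n : ℕ} (Ω : Set (Euc n)) (C : ℝ) (x₀ : Euc n) : Prop :=
  ∀ x ∈ Ω, ∃ γ : ℝ → Euc n,
    ContinuousOn γ (Icc 0 1) ∧ γ 0 = x₀ ∧ γ 1 = x ∧ MapsTo γ (Icc 0 1) Ω ∧
    ∃ j : ℕ, ∃ U : Fin (j + 1) → Set (Euc n),
      (∀ i, IsOpen (U i) ∧ U i ⊆ Ω) ∧
      (Pairwise fun i₁ i₂ => Disjoint (U i₁) (U i₂)) ∧
      -- (1)
      x₀ ∈ U 0 ∧ x ∈ U (Fin.last j) ∧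
      (∀ i : Fin (j + 1), 0 < (i : ℕ) → (i : ℕ) < j →
        x₀ ∈ Ω \ closure (U i) ∧ x ∈ Ω \ closure (U i) ∧
        x ∉ connectedComponentIn (Ω \ closure (U i)) x₀) ∧
      -- (2)
      (∀ i : Fin (j + 1), 0 < (i : ℕ) → (i : ℕ) < j →
        ∀ γ' : ℝ → Euc n, ContinuousOn γ' (Icc 0 1) → MapsTo γ' (Icc 0 1) Ω →
          (∃ t ∈ Icc (0:ℝ) 1, γ' t = x) → (∃ t ∈ Icc (0:ℝ) 1, γ' t = x₀) →
          ENNReal.ofReal (diam (U i)) ≤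
            ENNReal.ofReal C * eVariationOn γ' {t ∈ Icc (0:ℝ) 1 | γ' t ∈ U i}) ∧
      -- (3)
      (∀ t ∈ Icc (0:ℝ) 1,
        ball (γ t) (infDist (γ t) (frontier Ω) / C) ⊆ ⋃ i, closure (U i)) ∧
      -- (4)
      (∀ i : Fin (j + 1), ∀ t ∈ Icc (0:ℝ) 1, γ t ∈ U i →
        diam (U i) ≤ C * infDist (γ t) (frontier Ω)) ∧
      (∀ i : Fin (j + 1), ∃ xi ∈ U i, (∃ t ∈ Icc (0:ℝ) 1, γ t = xi) ∧
        ((i : ℕ) = j → xi = x) ∧ ball xi (infDist xi (frontier Ω) / C) ⊆ U i)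

/-- `Ω` satisfies the slice condition. -/
def SliceCondition {n : ℕ} (Ω : Set (Euc n)) : Prop :=
  ∃ C : ℝ, 1 < C ∧ ∀ x₀ ∈ Ω, HasSliceProperty Ω C x₀

/-- `Ω` is LLC. -/
def IsLLC {n : ℕ} (Ω : Set (Euc n)) : Prop :=
  ∃ b : ℝ, 0 < b ∧ b ≤ 1 ∧ ∀ z : Euc n, ∀ r : ℝ, 0 < r →
    (∀ x ∈ Ω ∩ ball z r, ∀ y ∈ Ω ∩ ball z r, JoinedByCurveIn (Ω ∩ ball z (r / b)) x y) ∧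
    (∀ x ∈ Ω \ ball z r, ∀ y ∈ Ω \ ball z r, JoinedByCurveIn (Ω \ ball z (b * r)) x y)

/-- `Ω` is quasiconvex. -/
def IsQuasiconvex {n : ℕ} (Ω : Set (Euc n)) : Prop :=
  ∃ C : ℝ, 1 ≤ C ∧ ∀ x ∈ Ω, ∀ y ∈ Ω, ∃ γ : ℝ → Euc n,
    ContinuousOn γ (Icc 0 1) ∧ γ 0 = x ∧ γ 1 = y ∧ MapsTo γ (Icc 0 1) Ω ∧
    eVariationOn γ (Icc 0 1) ≤ ENNReal.ofReal (C * dist x y)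

/-- The intrinsic (inner) metric of `Ω` (`∞` if there is no rectifiable curve). -/
def intrinsicDist {n : ℕ} (Ω : Set (Euc n)) (x y : Euc n) : ℝ≥0∞ :=
  ⨅ (γ : ℝ → Euc n)
    (_ : ContinuousOn γ (Icc 0 1) ∧ γ 0 = x ∧ γ 1 = y ∧ MapsTo γ (Icc 0 1) Ω),
    eVariationOn γ (Icc 0 1)

/-- The intrinsic ball `B_Ω(x, r)`. -/
def intrinsicBall {n : ℕ} (Ω : Set (Euc n)) (x : Euc n) (r : ℝ) : Set (Euc n) :=
  {y ∈ Ω | intrinsicDist Ω x y < ENNReal.ofReal r}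

/-- `Ω` is intrinsic Ahlfors `n`-regular. -/
def IntrinsicAhlforsRegular {n : ℕ} (Ω : Set (Euc n)) : Prop :=
  ∃ c : ℝ, 0 < c ∧ c < 1 ∧ ∃ r₀ : ℝ, 0 < r₀ ∧ ∀ x ∈ Ω, ∀ r : ℝ, 0 < r → r < r₀ →
    ENNReal.ofReal c * volume (ball x r) ≤ volume (intrinsicBall Ω x r)

/-- `Ω` is a local Sobolev–Poincaré imbedding domain of order `p`, `1 ≤ p < n`. -/
def LocalSPLow (n : ℕ) (Ω : Set (Euc n)) (p : ℝ) : Prop :=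
  ∃ C : ℝ, 1 ≤ C ∧ ∃ lam : ℝ, 1 ≤ lam ∧
    ∀ u : Euc n → ℝ, LocallyLipschitzOnSet u Ω →
      ∀ x ∈ Ω, ∀ r : ℝ, 0 < r → r < diam Ω →
        (⨅ c : ℝ, (∫⁻ y in ball x r ∩ Ω,
            ENNReal.ofReal |u y - c| ^ ((n : ℝ) * p / ((n : ℝ) - p)) ∂volume)
              ^ (((n : ℝ) - p) / ((n : ℝ) * p)))
          ≤ ENNReal.ofReal C *
            (∫⁻ y in ball x (lam * r) ∩ Ω,
              ENNReal.ofReal ‖fderiv ℝ u y‖ ^ p ∂volume) ^ (1 / p)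

/-- `Ω` is a local Sobolev–Poincaré imbedding domain of order `n`
(local Trudinger inequality). -/
def LocalSPn (n : ℕ) (Ω : Set (Euc n)) : Prop :=
  ∃ C : ℝ, 1 ≤ C ∧ ∃ lam : ℝ, 1 ≤ lam ∧ ∃ A : ℝ, 0 < A ∧
    ∀ u : Euc n → ℝ, LocallyLipschitzOnSet u Ω →
      ∀ x ∈ Ω, ∀ r : ℝ, 0 < r → r < diam Ω →
        0 < (∫⁻ y in ball x (lam * r) ∩ Ω,
              ENNReal.ofReal ‖fderiv ℝ u y‖ ^ (n : ℝ) ∂volume) →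
        (∫⁻ y in ball x (lam * r) ∩ Ω,
              ENNReal.ofReal ‖fderiv ℝ u y‖ ^ (n : ℝ) ∂volume) < ⊤ →
        (⨅ c : ℝ, ∫⁻ y in ball x r ∩ Ω,
            ENNReal.ofReal (Real.exp ((A * |u y - c| /
              (∫⁻ z in ball x (lam * r) ∩ Ω,
                ENNReal.ofReal ‖fderiv ℝ u z‖ ^ (n : ℝ) ∂volume).toReal
                  ^ ((1 : ℝ) / (n : ℝ))) ^ ((n : ℝ) / ((n : ℝ) - 1)))) ∂volume)
          ≤ ENNReal.ofReal C * volume (ball x r)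

/-- `Ω` is a local Sobolev–Poincaré imbedding domain of order `p`, `n < p < ∞`
(local Morrey inequality). -/
def LocalSPHigh (n : ℕ) (Ω : Set (Euc n)) (p : ℝ) : Prop :=
  ∃ C : ℝ, 1 ≤ C ∧ ∃ lam : ℝ, 1 ≤ lam ∧
    ∀ u : Euc n → ℝ, LocallyLipschitzOnSet u Ω →
      ∀ x ∈ Ω, ∀ r : ℝ, 0 < r → r < diam Ω →
        ∀ x₁ ∈ ball x r ∩ Ω, ∀ x₂ ∈ ball x r ∩ Ω,
          ENNReal.ofReal |u x₁ - u x₂| ≤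
            ENNReal.ofReal (C * dist x₁ x₂ ^ (1 - (n : ℝ) / p)) *
              (∫⁻ y in ball x (lam * r) ∩ Ω,
                ENNReal.ofReal ‖fderiv ℝ u y‖ ^ p ∂volume) ^ (1 / p)

/-- `Ω` is a `p`-Poincaré domain. -/
def PoincareDomain (n : ℕ) (Ω : Set (Euc n)) (p : ℝ) : Prop :=
  ∃ C : ℝ, 1 ≤ C ∧ ∃ lam : ℝ, 1 ≤ lam ∧
    ∀ u : Euc n → ℝ, LocallyLipschitzOnSet u Ω →
      ∀ x ∈ Ω, ∀ r : ℝ, 0 < r → r < diam Ω →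
        (volume (ball x r ∩ Ω))⁻¹ *
          (∫⁻ y in ball x r ∩ Ω,
            ENNReal.ofReal |u y - ⨍ z in ball x r ∩ Ω, u z ∂volume| ∂volume)
          ≤ ENNReal.ofReal (C * r) *
            ((volume (ball x (lam * r) ∩ Ω))⁻¹ *
              ∫⁻ y in ball x (lam * r) ∩ Ω,
                ENNReal.ofReal ‖fderiv ℝ u y‖ ^ p ∂volume) ^ (1 / p)


/-- The volume of the unit ball of `ℝⁿ`. -/
def unitBallVolume (n : ℕ) : ℝ := (volume (ball (0 : Euc n) 1)).toReal

lemma unitBallVolume_pos (n : ℕ) : 0 < unitBallVolume n :=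
  ENNReal.toReal_pos (measure_ball_pos volume _ one_pos).ne' measure_ball_lt_top.ne

lemma volume_ball_eq_ofReal {n : ℕ} (hn : 2 ≤ n) (x : Euc n) {r : ℝ} (hr : 0 ≤ r) :
    volume (ball x r) = ENNReal.ofReal (unitBallVolume n * r ^ n) := by
  have : Nontrivial (Fin n) := Fin.nontrivial_iff_two_le.mpr hn
  have : Nontrivial (Euc n) := inferInstance
  rw [Measure.addHaar_ball volume x hr, mul_comm (unitBallVolume n),
    ENNReal.ofReal_mul (by positivity), unitBallVolume,
    ENNReal.ofReal_toReal measure_ball_lt_top.ne]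
  simp

lemma pow_le_factorial_mul_exp_rpow (k : ℕ) {t q : ℝ} (ht : 0 ≤ t) (hq : 1 ≤ q) :
    t ^ k ≤ (k.factorial : ℝ) * Real.exp (t ^ q) := by
  have hk : (1 : ℝ) ≤ k.factorial := by exact_mod_cast Nat.one_le_iff_ne_zero.mpr k.factorial_ne_zero
  rcases le_total t 1 with h | h
  · calc t ^ k ≤ 1 := pow_le_one₀ ht h
      _ ≤ (k.factorial : ℝ) * Real.exp (t ^ q) :=
        one_le_mul_of_one_le_of_one_le hk (Real.one_le_exp (Real.rpow_nonneg ht q))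
  · have h1 := Real.pow_div_factorial_le_exp t ht k
    rw [div_le_iff₀ (by positivity)] at h1
    have h2 : t ≤ t ^ q := Real.self_le_rpow_of_one_le h hq
    calc t ^ k ≤ Real.exp t * k.factorial := h1
      _ ≤ (k.factorial : ℝ) * Real.exp (t ^ q) := by
        rw [mul_comm]; gcongr

/-- The local Trudinger inequality controls every power of the oscillation, as long as the
gradient is not trivial. -/
lemma exists_lintegral_pow_le_of_pos {n : ℕ} (hn : 2 ≤ n) {Ω : Set (Euc n)}
    (h : LocalSPn n Ω) (k : ℕ) :
    ∃ D : ℝ, 0 < D ∧ ∃ lam : ℝ, 1 ≤ lam ∧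
      ∀ u : Euc n → ℝ, LocallyLipschitzOnSet u Ω →
        ∀ x ∈ Ω, ∀ r : ℝ, 0 < r → r < diam Ω → ∀ J : ℝ, 0 < J →
          0 < (∫⁻ y in ball x (lam * r) ∩ Ω,
              ENNReal.ofReal ‖fderiv ℝ u y‖ ^ (n : ℝ) ∂volume) →
          (∫⁻ y in ball x (lam * r) ∩ Ω,
              ENNReal.ofReal ‖fderiv ℝ u y‖ ^ (n : ℝ) ∂volume) ≤ ENNReal.ofReal (J ^ n) →
          ∃ c : ℝ, ∫⁻ y in ball x r ∩ Ω, ENNReal.ofReal (|u y - c| ^ k) ∂volume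
            ≤ ENNReal.ofReal (D * J ^ k * r ^ n) := by
  obtain ⟨C, hC, lam, hlam, A, hA, H⟩ := h
  have hV := unitBallVolume_pos n
  refine ⟨(k.factorial : ℝ) / A ^ k * (2 * C) * unitBallVolume n, by positivity, lam, hlam, ?_⟩
  intro u hu x hx r hr hrd J hJ hpos hle
  set I := ∫⁻ y in ball x (lam * r) ∩ Ω, ENNReal.ofReal ‖fderiv ℝ u y‖ ^ (n : ℝ) ∂volume with hI
  have hfin : I < ⊤ := hle.trans_lt ENNReal.ofReal_lt_top
  have hn0 : (0 : ℝ) < n := by positivity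
  have hn1 : (1 : ℝ) < n := by exact_mod_cast hn
  set N : ℝ := I.toReal ^ ((1 : ℝ) / (n : ℝ)) with hN
  have hIpos : 0 < I.toReal := ENNReal.toReal_pos hpos.ne' hfin.ne
  have hNpos : 0 < N := Real.rpow_pos_of_pos hIpos _
  have hNJ : N ≤ J := by
    have h1 : I.toReal ≤ J ^ n := ENNReal.toReal_le_of_le_ofReal (by positivity) hle
    calc N ≤ (J ^ n) ^ ((1 : ℝ) / (n : ℝ)) :=
          Real.rpow_le_rpow hIpos.le h1 (by positivity)
      _ = J := by
        rw [one_div]; exact Real.pow_rpow_inv_natCast hJ.le (by omega)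
  have hq : 1 ≤ (n : ℝ) / ((n : ℝ) - 1) := by
    rw [le_div_iff₀ (by linarith)]; linarith
  have hlt : ENNReal.ofReal C * volume (ball x r) < ENNReal.ofReal (2 * C) * volume (ball x r) := by
    refine ENNReal.mul_lt_mul_left (measure_ball_pos volume x hr).ne' measure_ball_lt_top.ne ?_
    exact (ENNReal.ofReal_lt_ofReal_iff (by linarith)).mpr (by linarith)
  obtain ⟨c, hc⟩ := iInf_lt_iff.mp ((H u hu x hx r hr hrd hpos hfin).trans_lt hlt)
  refine ⟨c, ?_⟩
  calc ∫⁻ y in ball x r ∩ Ω, ENNReal.ofReal (|u y - c| ^ k) ∂volume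
      ≤ ∫⁻ y in ball x r ∩ Ω, ENNReal.ofReal ((k.factorial : ℝ) * (N / A) ^ k) *
          ENNReal.ofReal (Real.exp ((A * |u y - c| / N) ^ ((n : ℝ) / ((n : ℝ) - 1)))) := by
        refine lintegral_mono fun y => ?_
        rw [← ENNReal.ofReal_mul (by positivity)]
        refine ENNReal.ofReal_le_ofReal ?_
        have h1 := pow_le_factorial_mul_exp_rpow k (t := A * |u y - c| / N) (by positivity) hq
        have h2 : |u y - c| ^ k = (N / A) ^ k * (A * |u y - c| / N) ^ k := by
          rw [← mul_pow]; congr 1; field_simp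
        rw [h2, mul_comm (k.factorial : ℝ), mul_assoc]
        gcongr
    _ = ENNReal.ofReal ((k.factorial : ℝ) * (N / A) ^ k) * ∫⁻ y in ball x r ∩ Ω,
          ENNReal.ofReal (Real.exp ((A * |u y - c| / N) ^ ((n : ℝ) / ((n : ℝ) - 1)))) :=
        lintegral_const_mul' _ _ ENNReal.ofReal_ne_top
    _ ≤ ENNReal.ofReal ((k.factorial : ℝ) * (J / A) ^ k) *
          (ENNReal.ofReal (2 * C) * volume (ball x r)) := by
        gcongr
    _ = ENNReal.ofReal
          ((k.factorial : ℝ) / A ^ k * (2 * C) * unitBallVolume n * J ^ k * r ^ n) := by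
        rw [volume_ball_eq_ofReal hn x hr.le, ← ENNReal.ofReal_mul (by positivity),
          ← ENNReal.ofReal_mul (by positivity)]
        congr 1
        rw [div_pow]; ring

lemma LocallyLipschitzOnSet.add_lipschitz {n : ℕ} {u : Euc n → ℝ} {Ω : Set (Euc n)}
    (hu : LocallyLipschitzOnSet u Ω) {v : Euc n → ℝ} {K : ℝ≥0} (hv : LipschitzWith K v) :
    LocallyLipschitzOnSet (fun y => u y + v y) Ω := by
  intro x hx
  obtain ⟨K', s, hs, hK⟩ := hu x hx
  exact ⟨K' + K, s, hs, hK.add hv.lipschitzOnWith⟩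

/-- A locally Lipschitz function is differentiable at some point of every open set, and this point
can be chosen outside any prescribed null set. -/
lemma LocallyLipschitzOnSet.exists_differentiableAt {n : ℕ} {u : Euc n → ℝ} {Ω U : Set (Euc n)}
    (hu : LocallyLipschitzOnSet u Ω) (hU : IsOpen U) (hUΩ : U ⊆ Ω) (hne : U.Nonempty)
    {P : Euc n → Prop} (hP : ∀ᵐ y ∂(volume.restrict U), P y) :
    ∃ y ∈ U, DifferentiableAt ℝ u y ∧ P y := by
  obtain ⟨x, hx⟩ := hne
  obtain ⟨K, s, hs, hK⟩ := hu x (hUΩ hx)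
  have hsU : s ∩ U ∈ nhds x := by
    have : s ∈ nhdsWithin x U := nhdsWithin_mono x hUΩ hs
    rw [hU.nhdsWithin_eq hx] at this
    exact Filter.inter_mem this (hU.mem_nhds hx)
  obtain ⟨η, hη, hball⟩ := Metric.mem_nhds_iff.mp hsU
  have h1 : ∀ᵐ y ∂(volume.restrict (ball x η)), P y :=
    ae_restrict_of_ae_restrict_of_subset (fun y hy => (hball hy).2) hP
  have h2 : ∀ᵐ y ∂(volume.restrict (ball x η)), DifferentiableWithinAt ℝ u (ball x η) y :=
    (hK.mono fun y hy => (hball hy).1).ae_differentiableWithinAt measurableSet_ball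
  have h3 := (h1.and h2).and (ae_restrict_mem measurableSet_ball)
  have : (ae (volume.restrict (ball x η))).NeBot := by
    rw [ae_neBot, Ne, Measure.restrict_eq_zero]
    exact (measure_ball_pos volume x hη).ne'
  obtain ⟨y, ⟨hy1, hy2⟩, hy3⟩ := h3.exists
  exact ⟨y, (hball hy3).2, hy2.differentiableAt (isOpen_ball.mem_nhds hy3), hy1⟩

lemma fderiv_eq_zero_ae_of_lintegral_eq_zero {n : ℕ} {u : Euc n → ℝ}
    {S : Set (Euc n)}
    (h : ∫⁻ y in S, ENNReal.ofReal ‖fderiv ℝ u y‖ ^ (n : ℝ) ∂volume = 0) :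
    ∀ᵐ y ∂(volume.restrict S), fderiv ℝ u y = 0 := by
  have hmeas : Measurable fun y => ENNReal.ofReal ‖fderiv ℝ u y‖ ^ (n : ℝ) :=
    ((measurable_fderiv ℝ u).norm.ennreal_ofReal).pow_const _
  filter_upwards [(lintegral_eq_zero_iff hmeas).mp h] with y hy
  rw [ENNReal.rpow_natCast, Pi.zero_apply] at hy
  simpa only [ENNReal.ofReal_eq_zero, norm_le_zero_iff] using eq_zero_of_pow_eq_zero hy

/-- The local Trudinger inequality controls every power of the oscillation. -/
lemma exists_lintegral_pow_le {n : ℕ} (hn : 2 ≤ n) {Ω : Set (Euc n)} (hOpen : IsOpen Ω)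
    (hBdd : Bornology.IsBounded Ω) (h : LocalSPn n Ω) (k : ℕ) :
    ∃ D : ℝ, 0 < D ∧ ∃ lam : ℝ, 1 ≤ lam ∧
      ∀ u : Euc n → ℝ, LocallyLipschitzOnSet u Ω →
        ∀ x ∈ Ω, ∀ r : ℝ, 0 < r → r < diam Ω → ∀ J : ℝ, 0 < J →
          (∫⁻ y in ball x (lam * r) ∩ Ω,
              ENNReal.ofReal ‖fderiv ℝ u y‖ ^ (n : ℝ) ∂volume) ≤ ENNReal.ofReal (J ^ n) →
          ∃ c : ℝ, ∫⁻ y in ball x r ∩ Ω, ENNReal.ofReal (|u y - c| ^ k) ∂volume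
            ≤ ENNReal.ofReal (D * J ^ k * r ^ n) := by
  obtain ⟨D, hD, lam, hlam, H⟩ := exists_lintegral_pow_le_of_pos hn h k
  have hV := unitBallVolume_pos n
  refine ⟨2 ^ k * (D + unitBallVolume n), by positivity, lam, hlam, ?_⟩
  intro u hu x hx r hr hrd J hJ hle
  rcases eq_or_ne (∫⁻ y in ball x (lam * r) ∩ Ω,
      ENNReal.ofReal ‖fderiv ℝ u y‖ ^ (n : ℝ) ∂volume) 0 with h0 | h0
  swap
  · obtain ⟨c, hc⟩ := H u hu x hx r hr hrd J hJ (pos_iff_ne_zero.mpr h0) hle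
    refine ⟨c, hc.trans (ENNReal.ofReal_le_ofReal ?_)⟩
    gcongr
    have : (1 : ℝ) ≤ 2 ^ k := one_le_pow₀ (by norm_num)
    nlinarith
  have : Nontrivial (Fin n) := Fin.nontrivial_iff_two_le.mpr hn
  have : Nontrivial (Euc n) := inferInstance
  obtain ⟨e, he⟩ := exists_norm_eq (Euc n) (zero_le_one (α := ℝ))
  obtain ⟨M, hM⟩ := hBdd.exists_norm_le
  have hM0 : 0 ≤ M := (norm_nonneg x).trans (hM x hx)
  set W := (volume Ω).toReal with hW
  have hΩfin : volume Ω ≠ ⊤ := hBdd.measure_lt_top.ne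
  have hW0 : 0 ≤ W := ENNReal.toReal_nonneg
  set ε : ℝ := J / (1 + M + W) with hε
  have hε0 : 0 < ε := by positivity
  set L : Euc n →L[ℝ] ℝ := ε • innerSL ℝ e with hL
  have hLn : ‖L‖ = ε := by
    rw [hL, norm_smul, innerSL_apply_norm, he, mul_one, Real.norm_of_nonneg hε0.le]
  have hLΩ : ∀ y ∈ Ω, |L y| ≤ J := by
    intro y hy
    have h1 := L.le_opNorm y
    rw [hLn, Real.norm_eq_abs] at h1
    calc |L y| ≤ ε * ‖y‖ := h1
      _ ≤ ε * (1 + M + W) := by gcongr; linarith [hM y hy]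
      _ = J := by rw [hε]; field_simp
  have hv := hu.add_lipschitz L.lipschitz
  have hfd := fderiv_eq_zero_ae_of_lintegral_eq_zero h0
  have hSopen : IsOpen (ball x (lam * r) ∩ Ω) := isOpen_ball.inter hOpen
  have hxS : x ∈ ball x (lam * r) ∩ Ω := ⟨mem_ball_self (by positivity), hx⟩
  have hpos : 0 < ∫⁻ y in ball x (lam * r) ∩ Ω,
      ENNReal.ofReal ‖fderiv ℝ (fun y => u y + L y) y‖ ^ (n : ℝ) ∂volume := by
    refine pos_iff_ne_zero.mpr fun hz => ?_
    obtain ⟨y, -, hy, hy1, hy2⟩ := hu.exists_differentiableAt hSopen inter_subset_right ⟨x, hxS⟩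
      (hfd.and (fderiv_eq_zero_ae_of_lintegral_eq_zero hz))
    rw [fderiv_fun_add hy L.differentiableAt, hy1, zero_add, L.fderiv] at hy2
    rw [hy2, norm_zero] at hLn
    exact hε0.ne hLn
  have hle' : (∫⁻ y in ball x (lam * r) ∩ Ω,
      ENNReal.ofReal ‖fderiv ℝ (fun y => u y + L y) y‖ ^ (n : ℝ) ∂volume)
        ≤ ENNReal.ofReal (J ^ n) := by
    calc (∫⁻ y in ball x (lam * r) ∩ Ω,
          ENNReal.ofReal ‖fderiv ℝ (fun y => u y + L y) y‖ ^ (n : ℝ) ∂volume)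
        ≤ ∫⁻ y in ball x (lam * r) ∩ Ω, ENNReal.ofReal (ε ^ n) ∂volume := by
          refine lintegral_mono_ae ?_
          filter_upwards [hfd] with y hy
          rw [ENNReal.rpow_natCast, ← ENNReal.ofReal_pow (norm_nonneg _)]
          refine ENNReal.ofReal_le_ofReal (pow_le_pow_left₀ (norm_nonneg _) ?_ n)
          by_cases hd : DifferentiableAt ℝ u y
          · rw [fderiv_fun_add hd L.differentiableAt, hy, zero_add, L.fderiv, hLn]
          · rw [fderiv_zero_of_not_differentiableAt, norm_zero]
            · exact hε0.le
            · intro hd'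
              refine hd ?_
              simpa using hd'.sub (L.differentiableAt (x := y))
      _ = ENNReal.ofReal (ε ^ n) * volume (ball x (lam * r) ∩ Ω) := setLIntegral_const _ _
      _ ≤ ENNReal.ofReal (ε ^ n) * volume Ω := by gcongr; exact inter_subset_right
      _ = ENNReal.ofReal (ε ^ n * W) := by
          rw [ENNReal.ofReal_mul (by positivity), ENNReal.ofReal_toReal hΩfin]
      _ ≤ ENNReal.ofReal (J ^ n) := by
          refine ENNReal.ofReal_le_ofReal ?_
          have h1 : W ≤ (1 + M + W) ^ n :=
            (by linarith : W ≤ 1 + M + W).trans (le_self_pow₀ (by linarith) (by omega))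
          calc ε ^ n * W ≤ ε ^ n * (1 + M + W) ^ n := by gcongr
            _ = J ^ n := by rw [← mul_pow, hε]; congr 1; field_simp
  obtain ⟨c, hc⟩ := H _ hv x hx r hr hrd J hJ hpos hle'
  refine ⟨c, ?_⟩
  calc ∫⁻ y in ball x r ∩ Ω, ENNReal.ofReal (|u y - c| ^ k) ∂volume
      ≤ ∫⁻ y in ball x r ∩ Ω, ENNReal.ofReal (2 ^ k) *
          (ENNReal.ofReal (|u y + L y - c| ^ k) + ENNReal.ofReal (J ^ k)) ∂volume := by
        refine setLIntegral_mono' (measurableSet_ball.inter hOpen.measurableSet) fun y hy => ?_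
        rw [← ENNReal.ofReal_add (by positivity) (by positivity),
          ← ENNReal.ofReal_mul (by positivity)]
        refine ENNReal.ofReal_le_ofReal ?_
        have h1 : |u y - c| ≤ |u y + L y - c| + J := by
          have := abs_sub (u y + L y - c) (L y)
          rw [show u y + L y - c - L y = u y - c by ring] at this
          linarith [hLΩ y hy.2]
        calc |u y - c| ^ k ≤ (|u y + L y - c| + J) ^ k := by gcongr
          _ ≤ 2 ^ (k - 1) * (|u y + L y - c| ^ k + J ^ k) :=
            add_pow_le (abs_nonneg _) hJ.le k
          _ ≤ 2 ^ k * (|u y + L y - c| ^ k + J ^ k) := by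
            gcongr
            · norm_num
            · omega
    _ = ENNReal.ofReal (2 ^ k) * ((∫⁻ y in ball x r ∩ Ω,
          ENNReal.ofReal (|u y + L y - c| ^ k) ∂volume) +
          ENNReal.ofReal (J ^ k) * volume (ball x r ∩ Ω)) := by
        rw [lintegral_const_mul' _ _ ENNReal.ofReal_ne_top,
          lintegral_add_right _ measurable_const, setLIntegral_const]
    _ ≤ ENNReal.ofReal (2 ^ k) * (ENNReal.ofReal (D * J ^ k * r ^ n) +
          ENNReal.ofReal (J ^ k) * volume (ball x r)) := by
        gcongr
        exact inter_subset_left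
    _ = ENNReal.ofReal (2 ^ k * (D + unitBallVolume n) * J ^ k * r ^ n) := by
        rw [volume_ball_eq_ofReal hn x hr.le, ← ENNReal.ofReal_mul (by positivity),
          ← ENNReal.ofReal_add (by positivity) (by positivity),
          ← ENNReal.ofReal_mul (by positivity)]
        congr 1
        ring

/-- The cut-off function equal to `1` on `ball x (s / 2)` and to `0` outside `ball x s`. -/
def radialCutoff {n : ℕ} (x : Euc n) (s : ℝ) (y : Euc n) : ℝ :=
  max (min 1 (2 - 2 / s * dist y x)) 0

lemma radialCutoff_lipschitz {n : ℕ} (x : Euc n) {s : ℝ} (hs : 0 < s) :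
    LipschitzWith (2 / s).toNNReal (radialCutoff x s) := by
  refine LipschitzWith.max_const (LipschitzWith.const_min ?_ 1) 0
  refine LipschitzWith.of_dist_le' fun y z => ?_
  rw [Real.dist_eq, show 2 - 2 / s * dist y x - (2 - 2 / s * dist z x)
    = -(2 / s * (dist y x - dist z x)) by ring, abs_neg, abs_mul, abs_of_pos (by positivity)]
  gcongr
  exact abs_dist_sub_le y z x

lemma radialCutoff_eq_one {n : ℕ} {x y : Euc n} {s : ℝ} (hs : 0 < s) (hy : y ∈ ball x (s / 2)) :
    radialCutoff x s y = 1 := by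
  have h1 : 2 / s * dist y x ≤ 1 := by
    calc 2 / s * dist y x ≤ 2 / s * (s / 2) := by gcongr; exact (mem_ball.mp hy).le
      _ = 1 := by field_simp
  rw [radialCutoff, min_eq_left (by linarith), max_eq_left zero_le_one]

lemma radialCutoff_eq_zero {n : ℕ} {x y : Euc n} {s : ℝ} (hs : 0 < s) (hy : y ∉ ball x s) :
    radialCutoff x s y = 0 := by
  have h1 : 2 ≤ 2 / s * dist y x := by
    calc 2 = 2 / s * s := by field_simp
      _ ≤ 2 / s * dist y x := by gcongr; simpa using hy
  rw [radialCutoff, max_eq_right]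
  exact (min_le_right _ _).trans (by linarith)

lemma lintegral_fderiv_radialCutoff_le {n : ℕ} (x : Euc n) {s : ℝ} (hs : 0 < s) (hn : n ≠ 0)
    {S Ω : Set (Euc n)} :
    ∫⁻ y in S ∩ Ω, ENNReal.ofReal ‖fderiv ℝ (radialCutoff x s) y‖ ^ (n : ℝ) ∂volume
      ≤ ENNReal.ofReal ((2 / s) ^ n) * volume (ball x s ∩ Ω) := by
  calc ∫⁻ y in S ∩ Ω, ENNReal.ofReal ‖fderiv ℝ (radialCutoff x s) y‖ ^ (n : ℝ) ∂volume
      ≤ ∫⁻ y in Ω, ENNReal.ofReal ‖fderiv ℝ (radialCutoff x s) y‖ ^ (n : ℝ) ∂volume :=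
        lintegral_mono_set inter_subset_right
    _ ≤ ∫⁻ y in Ω, (ball x s).indicator (fun _ => ENNReal.ofReal ((2 / s) ^ n)) y ∂volume := by
        refine lintegral_mono fun y => ?_
        simp only [ENNReal.rpow_natCast]
        by_cases hy : y ∈ ball x s
        · rw [indicator_of_mem hy, ← ENNReal.ofReal_pow (norm_nonneg _)]
          refine ENNReal.ofReal_le_ofReal (pow_le_pow_left₀ (norm_nonneg _) ?_ n)
          have h1 := norm_fderiv_le_of_lipschitz ℝ (x₀ := y) (radialCutoff_lipschitz x hs)
          rwa [Real.coe_toNNReal _ (by positivity)] at h1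
        · have hmin : IsLocalMin (radialCutoff x s) y := by
            refine Filter.Eventually.of_forall fun z => ?_
            rw [radialCutoff_eq_zero hs hy]
            exact le_max_right _ _
          rw [hmin.fderiv_eq_zero]
          simp [hn]
    _ = ENNReal.ofReal ((2 / s) ^ n) * volume (ball x s ∩ Ω) := by
        rw [lintegral_indicator_const measurableSet_ball, Measure.restrict_apply measurableSet_ball]

lemma measureReal_ball_inter_mono {n : ℕ} {Ω : Set (Euc n)} {x z : Euc n} {s t : ℝ}
    (h : ball x s ⊆ ball z t) : volume.real (ball x s ∩ Ω) ≤ volume.real (ball z t ∩ Ω) :=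
  measureReal_mono (inter_subset_inter_left _ h)
    ((measure_mono inter_subset_left).trans_lt measure_ball_lt_top).ne

/-- If the outer part of a ball is not too thin in `Ω`, then a thin inner ball decays. -/
lemma exists_measure_half_ball_le {n : ℕ} (hn : 2 ≤ n) {Ω : Set (Euc n)} (hOpen : IsOpen Ω)
    (hBdd : Bornology.IsBounded Ω) (h : LocalSPn n Ω) :
    ∃ K : ℝ, 0 < K ∧ ∀ x ∈ Ω, ∀ s : ℝ, 0 < s → 8 * s < diam Ω →
      2 * volume.real (ball x s ∩ Ω) ≤ volume.real (ball x (8 * s) ∩ Ω) →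
      ∀ w : ℝ, 0 < w → volume.real (ball x s ∩ Ω) ≤ (w * s) ^ n →
        volume.real (ball x (s / 2) ∩ Ω) ≤ K * w ^ (n + 1) * s ^ n := by
  obtain ⟨D, hD, lam, hlam, H⟩ := exists_lintegral_pow_le hn hOpen hBdd h (n + 1)
  refine ⟨2 ^ (n + 1) * D * 2 ^ (n + 1) * 8 ^ n, by positivity, ?_⟩
  intro x hx s hs hsd hhalf w hw hws
  have hfin : ∀ t, volume (ball x t ∩ Ω) ≠ ⊤ := fun t =>
    ((measure_mono inter_subset_left).trans_lt measure_ball_lt_top).ne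
  have hu : LocallyLipschitzOnSet (radialCutoff x s) Ω := fun y _ =>
    ⟨_, univ, Filter.univ_mem, (radialCutoff_lipschitz x hs).lipschitzOnWith⟩
  obtain ⟨c, hc⟩ := H _ hu x hx (8 * s) (by positivity) hsd (2 * w) (by positivity) (by
    refine (lintegral_fderiv_radialCutoff_le x hs (by omega)).trans ?_
    rw [← ENNReal.ofReal_toReal (hfin s), ← ENNReal.ofReal_mul (by positivity)]
    refine ENNReal.ofReal_le_ofReal ?_
    calc (2 / s) ^ n * (volume (ball x s ∩ Ω)).toReal ≤ (2 / s) ^ n * (w * s) ^ n := by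
          gcongr; exact hws
      _ = (2 * w) ^ n := by rw [← mul_pow]; congr 1; field_simp)
  have key : ∀ E ⊆ ball x (8 * s) ∩ Ω, MeasurableSet E →
      (∀ y ∈ E, 1 / 2 ≤ |radialCutoff x s y - c|) →
      volume.real E ≤ 2 ^ (n + 1) * D * 2 ^ (n + 1) * 8 ^ n * w ^ (n + 1) * s ^ n := by
    intro E hE hEm hEc
    have hEfin : volume E ≠ ⊤ := ((measure_mono hE).trans_lt (hfin (8 * s)).lt_top).ne
    have h1 : ENNReal.ofReal ((1 / 2) ^ (n + 1)) * volume E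
        ≤ ENNReal.ofReal (D * (2 * w) ^ (n + 1) * (8 * s) ^ n) := by
      calc ENNReal.ofReal ((1 / 2) ^ (n + 1)) * volume E
          = ∫⁻ y in E, ENNReal.ofReal ((1 / 2) ^ (n + 1)) ∂volume := (setLIntegral_const _ _).symm
        _ ≤ ∫⁻ y in E, ENNReal.ofReal (|radialCutoff x s y - c| ^ (n + 1)) ∂volume := by
            refine setLIntegral_mono' hEm fun y hy => ENNReal.ofReal_le_ofReal ?_
            gcongr
            exact hEc y hy
        _ ≤ _ := (lintegral_mono_set hE).trans hc
    rw [← ENNReal.ofReal_toReal hEfin, ← ENNReal.ofReal_mul (by positivity),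
      ENNReal.ofReal_le_ofReal_iff (by positivity)] at h1
    change (1 / 2) ^ (n + 1) * volume.real E ≤ _ at h1
    calc volume.real E = 2 ^ (n + 1) * ((1 / 2) ^ (n + 1) * volume.real E) := by
          rw [← mul_assoc, ← mul_pow]; norm_num
      _ ≤ 2 ^ (n + 1) * (D * (2 * w) ^ (n + 1) * (8 * s) ^ n) := by gcongr
      _ = _ := by rw [mul_pow, mul_pow]; ring
  have hms : volume.real (ball x (s / 2) ∩ Ω) ≤ volume.real (ball x s ∩ Ω) :=
    measureReal_ball_inter_mono (ball_subset_ball (by linarith))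
  by_cases hc2 : c ≤ 1 / 2
  · refine key _ (inter_subset_inter_left _ (ball_subset_ball (by linarith)))
      (measurableSet_ball.inter hOpen.measurableSet) fun y hy => ?_
    rw [radialCutoff_eq_one hs hy.1]
    exact le_trans (by linarith) (le_abs_self _)
  · have hsub : ball x s ∩ Ω ⊆ ball x (8 * s) ∩ Ω :=
      inter_subset_inter_left _ (ball_subset_ball (by linarith))
    have hm : MeasurableSet (ball x s ∩ Ω) := measurableSet_ball.inter hOpen.measurableSet
    have h2 := key ((ball x (8 * s) ∩ Ω) \ (ball x s ∩ Ω)) sdiff_subset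
      ((measurableSet_ball.inter hOpen.measurableSet).diff hm) fun y hy => by
        rw [radialCutoff_eq_zero hs fun hys => hy.2 ⟨hys, hy.1.2⟩, zero_sub, abs_neg]
        exact le_trans (by linarith) (le_abs_self _)
    rw [measureReal_sdiff hsub hm] at h2
    linarith

/-- Density of `Ω` at `x`: if `Ω` were thin in `ball x s`, then its density would keep decaying
towards the interior point `x`. -/
lemma exists_density_of_half {n : ℕ} (hn : 2 ≤ n) {Ω : Set (Euc n)} (hOpen : IsOpen Ω)
    (hBdd : Bornology.IsBounded Ω) (h : LocalSPn n Ω) :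
    ∃ δ : ℝ, 0 < δ ∧ ∀ x ∈ Ω, ∀ s : ℝ, 0 < s → 8 * s < diam Ω →
      2 * volume.real (ball x s ∩ Ω) ≤ volume.real (ball x (8 * s) ∩ Ω) →
        (δ * s) ^ n < volume.real (ball x s ∩ Ω) := by
  obtain ⟨K, hK, H⟩ := exists_measure_half_ball_le hn hOpen hBdd h
  have hV := unitBallVolume_pos n
  obtain ⟨δ, hδ, hδK, hδ1, hδV⟩ : ∃ δ : ℝ, 0 < δ ∧ K * δ ≤ (1 / 2) ^ n ∧ δ ≤ 1 ∧
      δ < unitBallVolume n := by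
    refine ⟨min (min ((1 / 2) ^ n / K) 1) (unitBallVolume n / 2), by positivity, ?_, ?_, ?_⟩
    · calc K * min (min ((1 / 2) ^ n / K) 1) (unitBallVolume n / 2) ≤ K * ((1 / 2) ^ n / K) := by
            gcongr; exact (min_le_left _ _).trans (min_le_left _ _)
        _ = (1 / 2) ^ n := by field_simp
    · exact (min_le_left _ _).trans (min_le_right _ _)
    · exact (min_le_right _ _).trans_lt (by linarith)
  refine ⟨δ, hδ, ?_⟩
  intro x hx s hs hsd hhalf
  by_contra! hthin
  have hpos : ∀ t, 0 < t → 0 < volume.real (ball x t ∩ Ω) := fun t ht => by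
    refine ENNReal.toReal_pos ?_
      ((measure_mono inter_subset_left).trans_lt measure_ball_lt_top).ne
    exact ((isOpen_ball.inter hOpen).measure_pos volume ⟨x, mem_ball_self ht, hx⟩).ne'
  have step : ∀ t, 0 < t → 8 * t < diam Ω →
      2 * volume.real (ball x t ∩ Ω) ≤ volume.real (ball x (8 * t) ∩ Ω) →
      volume.real (ball x t ∩ Ω) ≤ (δ * t) ^ n →
      volume.real (ball x (t / 2) ∩ Ω) ≤ (1 / 2) ^ n * volume.real (ball x t ∩ Ω) := by
    intro t ht htd hth htδ
    set m := volume.real (ball x t ∩ Ω) with hm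
    have hm0 : 0 < m := hpos t ht
    set w := m ^ ((n : ℝ)⁻¹) / t with hw
    have hw0 : 0 < w := by positivity
    have hwm : (w * t) ^ n = m := by
      rw [hw, div_mul_cancel₀ _ ht.ne']
      exact Real.rpow_inv_natCast_pow hm0.le (by omega)
    have hwδ : w ≤ δ := by
      rw [← hwm] at htδ
      exact le_of_mul_le_mul_right (le_of_pow_le_pow_left₀ (by omega) (by positivity) htδ) ht
    calc volume.real (ball x (t / 2) ∩ Ω) ≤ K * w ^ (n + 1) * t ^ n :=
          H x hx t ht htd hth w hw0 hwm.ge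
      _ = K * w * m := by rw [← hwm]; ring
      _ ≤ K * δ * m := by gcongr
      _ ≤ (1 / 2) ^ n * m := by gcongr
  have iter : ∀ j : ℕ,
      2 * volume.real (ball x (s / 2 ^ j) ∩ Ω) ≤ volume.real (ball x (8 * (s / 2 ^ j)) ∩ Ω) ∧
      volume.real (ball x (s / 2 ^ j) ∩ Ω) ≤ (δ * (s / 2 ^ j)) ^ n := by
    intro j
    induction j with
    | zero => simpa using ⟨hhalf, hthin⟩
    | succ j ih =>
      have ht : 0 < s / 2 ^ j := by positivity
      have htd : 8 * (s / 2 ^ j) < diam Ω := by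
        refine lt_of_le_of_lt ?_ hsd
        gcongr
        exact div_le_self hs.le (one_le_pow₀ (by norm_num))
      have h1 := step _ ht htd ih.1 ih.2
      have he : s / 2 ^ (j + 1) = s / 2 ^ j / 2 := by rw [pow_succ]; field_simp
      rw [he]
      set t := s / 2 ^ j
      constructor
      · have h2 : ((1 : ℝ) / 2) ^ n ≤ 1 / 2 :=
          pow_le_of_le_one (by norm_num) (by norm_num) (by omega)
        have h3 : volume.real (ball x t ∩ Ω) ≤ volume.real (ball x (8 * (t / 2)) ∩ Ω) :=
          measureReal_ball_inter_mono (ball_subset_ball (by linarith))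
        nlinarith [hpos t ht]
      · calc volume.real (ball x (t / 2) ∩ Ω) ≤ (1 / 2) ^ n * volume.real (ball x t ∩ Ω) := h1
          _ ≤ (1 / 2) ^ n * (δ * t) ^ n := by gcongr; exact ih.2
          _ = (δ * (t / 2)) ^ n := by rw [← mul_pow]; congr 1; ring
  obtain ⟨η, hη, hball⟩ := Metric.mem_nhds_iff.mp (hOpen.mem_nhds hx)
  obtain ⟨j, hj⟩ := exists_pow_lt_of_lt_one (div_pos hη hs) (by norm_num : (1 / 2 : ℝ) < 1)
  have hjη : s / 2 ^ j < η := by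
    rw [lt_div_iff₀ hs] at hj
    calc s / 2 ^ j = (1 / 2) ^ j * s := by rw [one_div, inv_pow]; ring
      _ < η := hj
  have h1 := (iter j).2
  rw [inter_eq_self_of_subset_left ((ball_subset_ball hjη.le).trans hball), Measure.real,
    volume_ball_eq_ofReal hn x (by positivity), ENNReal.toReal_ofReal (by positivity),
    mul_pow] at h1
  have h2 := le_of_mul_le_mul_right h1 (by positivity)
  have h3 : δ ^ n ≤ δ := pow_le_of_le_one hδ.le hδ1 (by omega)
  linarith

/-- A bounded connected local Trudinger domain satisfies the measure density condition. -/
lemma exists_measure_density {n : ℕ} (hn : 2 ≤ n) {Ω : Set (Euc n)} (hOpen : IsOpen Ω)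
    (hConn : IsConnected Ω) (hBdd : Bornology.IsBounded Ω) (h : LocalSPn n Ω) :
    ∃ δ : ℝ, 0 < δ ∧ ∀ x ∈ Ω, ∀ r : ℝ, 0 < r → r < diam Ω →
      δ * r ^ n ≤ volume.real (ball x r ∩ Ω) := by
  obtain ⟨δ, hδ, H⟩ := exists_density_of_half hn hOpen hBdd h
  refine ⟨(δ / 8) ^ n, by positivity, ?_⟩
  intro x hx r hr hrd
  have hlarge : ∀ w ∈ Ω, ball w (r / 8) ⊆ ball x r →
      2 * volume.real (ball w (r / 8) ∩ Ω) ≤ volume.real (ball w (8 * (r / 8)) ∩ Ω) →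
      (δ / 8) ^ n * r ^ n ≤ volume.real (ball x r ∩ Ω) := by
    intro w hw hsub hw2
    calc (δ / 8) ^ n * r ^ n = (δ * (r / 8)) ^ n := by rw [← mul_pow]; congr 1; ring
      _ ≤ volume.real (ball w (r / 8) ∩ Ω) := (H w hw _ (by positivity) (by linarith) hw2).le
      _ ≤ _ := measureReal_ball_inter_mono hsub
  obtain ⟨z, hz, hzx⟩ : ∃ z ∈ Ω, dist z x = r / 4 := by
    obtain ⟨y, hy, hyx⟩ : ∃ y ∈ Ω, r / 4 ≤ dist y x := by
      by_contra! hall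
      have h1 : diam Ω ≤ 2 * (r / 4) :=
        diam_le_of_subset_closedBall (by positivity) fun y hy => (hall y hy).le
      linarith
    have hivt := hConn.isPreconnected.intermediate_value hx hy (f := fun y => dist y x)
      (by fun_prop)
    exact hivt ⟨by simpa using by positivity, hyx⟩
  have hdisj : Disjoint (ball x (r / 8) ∩ Ω) (ball z (r / 8) ∩ Ω) :=
    (ball_disjoint_ball (by rw [dist_comm, hzx]; linarith)).mono inter_subset_left inter_subset_left
  have hfin : ∀ (w : Euc n) t, volume (ball w t ∩ Ω) ≠ ⊤ := fun w t =>
    ((measure_mono inter_subset_left).trans_lt measure_ball_lt_top).ne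
  have hunion := measureReal_union hdisj (measurableSet_ball.inter hOpen.measurableSet)
    (h₁ := hfin _ _) (h₂ := hfin _ _) (μ := volume)
  have hin : ∀ w ∈ ({x, z} : Set (Euc n)), volume.real (ball x (r / 8) ∩ Ω) +
      volume.real (ball z (r / 8) ∩ Ω) ≤ volume.real (ball w (8 * (r / 8)) ∩ Ω) := by
    intro w hw
    rw [← hunion, ← union_inter_distrib_right]
    refine measureReal_mono (inter_subset_inter_left _ (union_subset ?_ ?_)) (hfin _ _) <;>
      refine ball_subset_ball' ?_ <;> rcases hw with hw | hw <;> rw [hw]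
    · rw [dist_self]; linarith
    · rw [dist_comm, hzx]; linarith
    · rw [hzx]; linarith
    · rw [dist_self]; linarith
  rcases le_total (volume.real (ball x (r / 8) ∩ Ω)) (volume.real (ball z (r / 8) ∩ Ω)) with hle | hle
  · refine hlarge x hx (ball_subset_ball (by linarith)) ?_
    linarith [hin x (by simp)]
  · refine hlarge z hz (ball_subset_ball' (by rw [hzx]; linarith)) ?_
    linarith [hin z (by simp)]

lemma LocallyLipschitzOnSet.continuousOn {n : ℕ} {u : Euc n → ℝ} {Ω : Set (Euc n)}
    (hu : LocallyLipschitzOnSet u Ω) : ContinuousOn u Ω := by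
  intro x hx
  obtain ⟨K, s, hs, hK⟩ := hu x hx
  exact (hK.continuousOn x (mem_of_mem_nhdsWithin hx hs)).mono_of_mem_nhdsWithin hs

/-- The mean is an almost optimal constant for the `L¹`-oscillation. -/
lemma lintegral_sub_average_le {α : Type*} [MeasurableSpace α] {μ : Measure α} [IsFiniteMeasure μ]
    {u : α → ℝ} (hu : AEStronglyMeasurable u μ) (c : ℝ) :
    ∫⁻ y, ENNReal.ofReal |u y - ⨍ z, u z ∂μ| ∂μ ≤ 2 * ∫⁻ y, ENNReal.ofReal |u y - c| ∂μ := by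
  rcases eq_or_ne μ 0 with rfl | hμ
  · simp
  have : NeZero μ := ⟨hμ⟩
  rcases eq_or_ne (∫⁻ y, ENNReal.ofReal |u y - c| ∂μ) ⊤ with htop | htop
  · rw [htop]; simp
  have hint : Integrable (fun y => u y - c) μ := by
    refine ⟨hu.sub aestronglyMeasurable_const, ?_⟩
    simpa only [HasFiniteIntegral, Real.enorm_eq_ofReal_abs] using htop.lt_top
  have huint : Integrable u μ := by
    refine (hint.add (integrable_const c)).congr (Filter.Eventually.of_forall fun y => ?_)
    simp
  have havg : ENNReal.ofReal |c - ⨍ z, u z ∂μ| * μ univ ≤ ∫⁻ y, ENNReal.ofReal |u y - c| ∂μ := by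
    have h1 : ∫ y, (u y - c) ∂μ = μ.real univ * ((⨍ z, u z ∂μ) - c) := by
      rw [integral_sub huint (integrable_const c), integral_const, mul_sub, smul_eq_mul,
        ← smul_eq_mul (μ.real univ) (⨍ z, u z ∂μ), measure_smul_average]
    have h2 := enorm_integral_le_lintegral_enorm (μ := μ) fun y => u y - c
    simp only [Real.enorm_eq_ofReal_abs] at h2
    rw [h1, abs_mul, abs_of_nonneg measureReal_nonneg, ENNReal.ofReal_mul measureReal_nonneg,
      Measure.real, ENNReal.ofReal_toReal (measure_ne_top _ _), abs_sub_comm, mul_comm] at h2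
    exact h2
  calc ∫⁻ y, ENNReal.ofReal |u y - ⨍ z, u z ∂μ| ∂μ
      ≤ ∫⁻ y, (ENNReal.ofReal |u y - c| + ENNReal.ofReal |c - ⨍ z, u z ∂μ|) ∂μ := by
        refine lintegral_mono fun y => ?_
        rw [← ENNReal.ofReal_add (abs_nonneg _) (abs_nonneg _)]
        exact ENNReal.ofReal_le_ofReal (abs_sub_le _ _ _)
    _ = (∫⁻ y, ENNReal.ofReal |u y - c| ∂μ) + ENNReal.ofReal |c - ⨍ z, u z ∂μ| * μ univ := by
        rw [lintegral_add_right _ measurable_const, lintegral_const]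
    _ ≤ 2 * ∫⁻ y, ENNReal.ofReal |u y - c| ∂μ := by
        rw [two_mul]; gcongr

/-- a bounded local Sobolev–Poincaré imbedding domain of order
`n` is an `n`-Poincaré domain. -/
theorem stmt14 (n : ℕ) (hn : 2 ≤ n)
    (Ω : Set (Euc n)) (hOpen : IsOpen Ω)
    (hConn : IsConnected Ω) (hBdd : Bornology.IsBounded Ω)
    (hSP : LocalSPn n Ω) :
    PoincareDomain n Ω (n : ℝ) := by
  obtain ⟨D, hD, lam, hlam, H⟩ := exists_lintegral_pow_le hn hOpen hBdd hSP 1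
  obtain ⟨δ, hδ, hdens⟩ := exists_measure_density hn hOpen hConn hBdd hSP
  have hV := unitBallVolume_pos n
  set G : ℝ := lam * (1 + unitBallVolume n) with hG
  have hG0 : 0 < G := by positivity
  refine ⟨max 1 (2 * D * G / δ), le_max_left _ _, lam, hlam, ?_⟩
  intro u hu x hx r hr hrd
  set I := ∫⁻ y in ball x (lam * r) ∩ Ω, ENNReal.ofReal ‖fderiv ℝ u y‖ ^ (n : ℝ) ∂volume with hI
  have hC0 : 0 < max 1 (2 * D * G / δ) := lt_max_of_lt_left one_pos
  have hn0 : (0 : ℝ) < n := by positivity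
  have hfin : ∀ t, volume (ball x t ∩ Ω) ≠ ⊤ := fun t =>
    ((measure_mono inter_subset_left).trans_lt measure_ball_lt_top).ne
  rcases eq_or_ne I ⊤ with htop | htop
  · rw [htop, ENNReal.mul_top (ENNReal.inv_ne_zero.mpr (hfin _)),
      ENNReal.top_rpow_of_pos (by positivity), ENNReal.mul_top]
    · exact le_top
    · exact (ENNReal.ofReal_pos.mpr (by positivity)).ne'
  set T : ℝ := I.toReal ^ ((n : ℝ)⁻¹) with hT
  have hT0 : 0 ≤ T := by positivity
  have hIT : I = ENNReal.ofReal (T ^ n) := by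
    rw [hT, Real.rpow_inv_natCast_pow ENNReal.toReal_nonneg (by omega), ENNReal.ofReal_toReal htop]
  have hinv : (volume (ball x r ∩ Ω))⁻¹ ≤ ENNReal.ofReal ((δ * r ^ n)⁻¹) := by
    rw [ENNReal.ofReal_inv_of_pos (by positivity), ENNReal.inv_le_inv,
      ENNReal.ofReal_le_iff_le_toReal (hfin r)]
    exact hdens x hx r hr hrd
  have hleft : (volume (ball x r ∩ Ω))⁻¹ * (∫⁻ y in ball x r ∩ Ω,
      ENNReal.ofReal |u y - ⨍ z in ball x r ∩ Ω, u z ∂volume| ∂volume)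
        ≤ ENNReal.ofReal (2 * D / δ * T) := by
    refine ENNReal.le_of_forall_pos_le_add fun ε hε _ => ?_
    have hε' : (0 : ℝ) < ε := hε
    set J : ℝ := T + δ * ε / (2 * D) with hJ
    have hJ0 : 0 < J := by positivity
    obtain ⟨c, hc⟩ := H u hu x hx r hr hrd J hJ0 (by
      rw [← hI, hIT]
      refine ENNReal.ofReal_le_ofReal (pow_le_pow_left₀ hT0 ?_ n)
      rw [hJ]
      exact le_add_of_nonneg_right (by positivity))
    simp only [pow_one] at hc
    have : IsFiniteMeasure (volume.restrict (ball x r ∩ Ω)) :=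
      ⟨by rw [Measure.restrict_apply_univ]; exact (hfin r).lt_top⟩
    have hmeas : AEStronglyMeasurable u (volume.restrict (ball x r ∩ Ω)) :=
      (hu.continuousOn.mono inter_subset_right).aestronglyMeasurable
        (measurableSet_ball.inter hOpen.measurableSet)
    calc (volume (ball x r ∩ Ω))⁻¹ * (∫⁻ y in ball x r ∩ Ω,
          ENNReal.ofReal |u y - ⨍ z in ball x r ∩ Ω, u z ∂volume| ∂volume)
        ≤ ENNReal.ofReal ((δ * r ^ n)⁻¹) * (2 * ENNReal.ofReal (D * J * r ^ n)) := by
          gcongr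
          refine (lintegral_sub_average_le hmeas c).trans ?_
          gcongr
      _ = ENNReal.ofReal (2 * D / δ * T + ε) := by
          rw [show (2 : ℝ≥0∞) = ENNReal.ofReal 2 by simp, ← ENNReal.ofReal_mul (by positivity),
            ← ENNReal.ofReal_mul (by positivity)]
          congr 1
          rw [hJ]
          field_simp
      _ = ENNReal.ofReal (2 * D / δ * T) + ε := by
          rw [ENNReal.ofReal_add (by positivity) hε'.le, ENNReal.ofReal_coe_nnreal]
  refine hleft.trans ?_
  have hvol : volume (ball x (lam * r) ∩ Ω) ≤ ENNReal.ofReal ((G * r) ^ n) := by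
    refine (measure_mono inter_subset_left).trans ?_
    rw [volume_ball_eq_ofReal hn x (by positivity)]
    refine ENNReal.ofReal_le_ofReal ?_
    have h1 : unitBallVolume n ≤ (1 + unitBallVolume n) ^ n :=
      (by linarith : unitBallVolume n ≤ 1 + unitBallVolume n).trans
        (le_self_pow₀ (by linarith) (by omega))
    calc unitBallVolume n * (lam * r) ^ n ≤ (1 + unitBallVolume n) ^ n * (lam * r) ^ n := by gcongr
      _ = (G * r) ^ n := by rw [← mul_pow, hG]; congr 1; ring
  calc ENNReal.ofReal (2 * D / δ * T)
      = ENNReal.ofReal ((2 * D * G / δ) * r * (T / (G * r))) := by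
        congr 1
        field_simp
    _ ≤ ENNReal.ofReal (max 1 (2 * D * G / δ) * r * (T / (G * r))) := by
        gcongr
        exact le_max_right _ _
    _ = ENNReal.ofReal (max 1 (2 * D * G / δ) * r) *
          (ENNReal.ofReal ((T / (G * r)) ^ n)) ^ (1 / (n : ℝ)) := by
        rw [ENNReal.ofReal_mul (by positivity),
          ENNReal.ofReal_rpow_of_nonneg (by positivity) (by positivity), one_div,
          Real.pow_rpow_inv_natCast (by positivity) (by omega)]
    _ ≤ ENNReal.ofReal (max 1 (2 * D * G / δ) * r) *
          ((volume (ball x (lam * r) ∩ Ω))⁻¹ * I) ^ (1 / (n : ℝ)) := by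
        gcongr
        rw [hIT, div_pow, div_eq_inv_mul, ENNReal.ofReal_mul (by positivity),
          ENNReal.ofReal_inv_of_pos (by positivity)]
        gcongr
end
end

section
/- Let n ≥ 2 and 1 ≤ p < n, and let Ω ⊂ ℝⁿ be a bounded domain which is a local Sobolev–Poincaré imbedding domain of order p, i.e. there exist constants C ≥ 1 and λ ≥ 1 such that for every locally Lipschitz function u : Ω → ℝ, every x ∈ Ω and every 0 < r < diam(Ω), inf_{c∈ℝ} (∫_{B(x,r)∩Ω} |u(y) − c|^{np/(n−p)} dy)^{(n−p)/(np)} ≤ C (∫_{B(x,λr)∩Ω} |∇u(y)|^p dy)^{1/p}. Then Ω is quasiconvex. -/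
open Set Metric MeasureTheory ENNReal NNReal

noncomputable section

section IntrinsicMetric

variable {n : ℕ} {Ω : Set (Euc n)}

theorem intrinsicDist_lt_iff {x y : Euc n} {r : ℝ≥0∞} :
    intrinsicDist Ω x y < r ↔ ∃ γ : ℝ → Euc n, ContinuousOn γ (Icc 0 1) ∧ γ 0 = x ∧ γ 1 = y ∧
      MapsTo γ (Icc 0 1) Ω ∧ eVariationOn γ (Icc 0 1) < r := by
  simp only [intrinsicDist, iInf_lt_iff, exists_prop, and_assoc]

theorem edist_le_intrinsicDist (x y : Euc n) : edist x y ≤ intrinsicDist Ω x y := by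
  refine le_iInf₂ fun γ hγ => ?_
  obtain ⟨-, rfl, rfl, -⟩ := hγ
  exact eVariationOn.edist_le γ (left_mem_Icc.2 zero_le_one) (right_mem_Icc.2 zero_le_one)

theorem intrinsicDist_comm_le (x y : Euc n) : intrinsicDist Ω y x ≤ intrinsicDist Ω x y := by
  refine le_iInf₂ fun γ hγ => ?_
  obtain ⟨hc, h0, h1, hm⟩ := hγ
  have hmaps : MapsTo (fun t : ℝ => 1 - t) (Icc 0 1) (Icc 0 1) := fun t ht =>
    ⟨by linarith [ht.2], by linarith [ht.1]⟩
  refine (iInf₂_le (γ ∘ fun t => 1 - t) ⟨hc.comp (by fun_prop) hmaps, by simp [h1], by simp [h0],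
    hm.comp hmaps⟩).trans ?_
  exact eVariationOn.comp_le_of_antitoneOn γ _ (fun a _ b _ hab => sub_le_sub_left hab 1) hmaps

theorem intrinsicDist_comm (x y : Euc n) : intrinsicDist Ω x y = intrinsicDist Ω y x :=
  le_antisymm (intrinsicDist_comm_le y x) (intrinsicDist_comm_le x y)

theorem intrinsicDist_triangle (x y z : Euc n) :
    intrinsicDist Ω x z ≤ intrinsicDist Ω x y + intrinsicDist Ω y z := by
  have key : ∀ γ₁ : ℝ → Euc n, ∀ γ₂ : ℝ → Euc n,
      (ContinuousOn γ₁ (Icc 0 1) ∧ γ₁ 0 = x ∧ γ₁ 1 = y ∧ MapsTo γ₁ (Icc 0 1) Ω) →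
      (ContinuousOn γ₂ (Icc 0 1) ∧ γ₂ 0 = y ∧ γ₂ 1 = z ∧ MapsTo γ₂ (Icc 0 1) Ω) →
      intrinsicDist Ω x z ≤ eVariationOn γ₁ (Icc 0 1) + eVariationOn γ₂ (Icc 0 1) := by
    rintro γ₁ γ₂ ⟨hc₁, h0₁, h1₁, hm₁⟩ ⟨hc₂, h0₂, h1₂, hm₂⟩
    set γ : ℝ → Euc n := fun t => if t ≤ 1 / 2 then γ₁ (2 * t) else γ₂ (2 * t - 1) with hγ
    have e₁ : EqOn γ (γ₁ ∘ fun t => 2 * t) (Icc 0 (1 / 2)) := fun t ht => by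
      simp only [hγ, Function.comp, if_pos ht.2]
    have e₂ : EqOn γ (γ₂ ∘ fun t => 2 * t - 1) (Icc (1 / 2) 1) := fun t ht => by
      rcases ht.1.eq_or_lt with h | h
      · subst h
        norm_num [hγ, h1₁, h0₂]
      · simp only [hγ, Function.comp, if_neg (not_le.2 h)]
    have m₁ : MapsTo (fun t : ℝ => 2 * t) (Icc 0 (1 / 2)) (Icc 0 1) := fun t ht =>
      ⟨by linarith [ht.1], by linarith [ht.2]⟩
    have m₂ : MapsTo (fun t : ℝ => 2 * t - 1) (Icc (1 / 2) 1) (Icc 0 1) := fun t ht =>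
      ⟨by linarith [ht.1], by linarith [ht.2]⟩
    have hU : Icc (0 : ℝ) (1 / 2) ∪ Icc (1 / 2) 1 = Icc 0 1 :=
      Icc_union_Icc_eq_Icc (by norm_num) (by norm_num)
    have hcont : ContinuousOn γ (Icc 0 1) := by
      rw [← hU]
      exact ContinuousOn.union_of_isClosed ((hc₁.comp (by fun_prop) m₁).congr e₁)
        ((hc₂.comp (by fun_prop) m₂).congr e₂) isClosed_Icc isClosed_Icc
    have hmaps : MapsTo γ (Icc 0 1) Ω := by
      rw [← hU]
      exact ((hm₁.comp m₁).congr e₁.symm).union_union ((hm₂.comp m₂).congr e₂.symm)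
        |>.mono_right (union_self Ω).le
    refine (iInf₂_le γ ⟨hcont, by norm_num [hγ, h0₁], by norm_num [hγ, h1₂], hmaps⟩).trans ?_
    have hadd := eVariationOn.Icc_add_Icc γ (s := univ) (a := 0) (b := 1 / 2) (c := 1)
      (by norm_num) (by norm_num) (mem_univ _)
    simp only [univ_inter] at hadd
    rw [← hadd, eVariationOn.eq_of_eqOn e₁, eVariationOn.eq_of_eqOn e₂]
    exact add_le_add
      (eVariationOn.comp_le_of_monotoneOn γ₁ _ (fun a _ b _ hab => by simpa using hab) m₁)
      (eVariationOn.comp_le_of_monotoneOn γ₂ _ (fun a _ b _ hab => by simpa using hab) m₂)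
  conv_rhs => rw [intrinsicDist, intrinsicDist]
  simp only [iInf_subtype', ENNReal.iInf_add, ENNReal.add_iInf]
  exact le_iInf fun γ₂ => le_iInf fun γ₁ => key γ₁ γ₂ γ₁.2 γ₂.2

theorem intrinsicDist_le_of_segment_subset {x y : Euc n} (h : segment ℝ x y ⊆ Ω) :
    intrinsicDist Ω x y ≤ edist x y := by
  set γ : ℝ → Euc n := fun t => AffineMap.lineMap x y t with hγ
  have hlip : LipschitzWith (nndist x y) γ := by
    simpa [hγ] using lipschitzWith_lineMap (𝕜 := ℝ) x y
  have hmaps : MapsTo γ (Icc 0 1) Ω := fun t ht =>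
    h (segment_eq_image_lineMap ℝ x y ▸ mem_image_of_mem _ ht)
  refine (iInf₂_le γ ⟨hlip.continuous.continuousOn, by simp [hγ], by simp [hγ], hmaps⟩).trans ?_
  have hvar := LipschitzOnWith.comp_eVariationOn_le (hlip.lipschitzOnWith (s := univ))
    (g := (id : ℝ → ℝ)) (mapsTo_univ _ (Icc 0 1))
  have hid := MonotoneOn.eVariationOn_eq (f := (id : ℝ → ℝ)) (s := Icc (0 : ℝ) 1) (a := 0) (b := 1)
    monotoneOn_id (by simp) (by simp)
  simp only [inter_self, id, sub_zero, ENNReal.ofReal_one] at hid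
  calc eVariationOn γ (Icc 0 1) ≤ nndist x y * eVariationOn (id : ℝ → ℝ) (Icc 0 1) := hvar
    _ = nndist x y * 1 := by rw [hid]
    _ = edist x y := by rw [mul_one, edist_nndist]

theorem intrinsicDist_le_edist_of_ball_subset {x y z : Euc n} {ρ : ℝ} (h : ball z ρ ⊆ Ω)
    (hx : x ∈ ball z ρ) (hy : y ∈ ball z ρ) : intrinsicDist Ω x y ≤ edist x y :=
  intrinsicDist_le_of_segment_subset (((convex_ball z ρ).segment_subset hx hy).trans h)

theorem intrinsicDist_self {x : Euc n} (hx : x ∈ Ω) : intrinsicDist Ω x x = 0 := by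
  have := intrinsicDist_le_of_segment_subset (x := x) (y := x) (Ω := Ω) (by simpa using hx)
  rwa [edist_self, nonpos_iff_eq_zero] at this

theorem intrinsicDist_ne_top (hO : IsOpen Ω) (hC : IsPreconnected Ω) {x y : Euc n}
    (hx : x ∈ Ω) (hy : y ∈ Ω) : intrinsicDist Ω x y ≠ ⊤ := by
  have hfin : ∀ z w ρ, ball z ρ ⊆ Ω → w ∈ ball z ρ → intrinsicDist Ω z w ≠ ⊤ :=
    fun z w ρ hρ hw => ((intrinsicDist_le_edist_of_ball_subset hρ
      (mem_ball_self (pos_of_mem_ball hw)) hw).trans_lt (edist_lt_top z w)).ne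
  have hsub : Ω ⊆ {z | z ∈ Ω ∧ intrinsicDist Ω x z ≠ ⊤} := by
    refine hC.subset_of_closure_inter_subset ?_ ⟨x, hx, hx, by simp [intrinsicDist_self hx]⟩ ?_
    · refine Metric.isOpen_iff.2 fun z hz => ?_
      obtain ⟨ρ, hρ, hb⟩ := Metric.isOpen_iff.1 hO z hz.1
      exact ⟨ρ, hρ, fun w hw => ⟨hb hw, ne_top_of_le_ne_top
        (ENNReal.add_ne_top.2 ⟨hz.2, hfin z w ρ hb hw⟩) (intrinsicDist_triangle x z w)⟩⟩
    · rintro z ⟨hzc, hz⟩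
      obtain ⟨ρ, hρ, hb⟩ := Metric.isOpen_iff.1 hO z hz
      obtain ⟨w, hw, hzw⟩ := Metric.mem_closure_iff.1 hzc ρ hρ
      refine ⟨hz, ne_top_of_le_ne_top (ENNReal.add_ne_top.2 ⟨hw.2, ?_⟩)
        (intrinsicDist_triangle x w z)⟩
      rw [intrinsicDist_comm]
      exact hfin z w ρ hb (by rwa [mem_ball, dist_comm])
  exact (hsub hy).2

theorem toReal_intrinsicDist_triangle (hO : IsOpen Ω) (hC : IsPreconnected Ω) {x y z : Euc n}
    (hx : x ∈ Ω) (hy : y ∈ Ω) (hz : z ∈ Ω) :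
    (intrinsicDist Ω x z).toReal ≤ (intrinsicDist Ω x y).toReal + (intrinsicDist Ω y z).toReal := by
  have h₁ := intrinsicDist_ne_top hO hC hx hy
  have h₂ := intrinsicDist_ne_top hO hC hy hz
  rw [← ENNReal.toReal_add h₁ h₂]
  exact ENNReal.toReal_mono (ENNReal.add_ne_top.2 ⟨h₁, h₂⟩) (intrinsicDist_triangle x y z)

theorem dist_le_toReal_intrinsicDist (hO : IsOpen Ω) (hC : IsPreconnected Ω) {x y : Euc n}
    (hx : x ∈ Ω) (hy : y ∈ Ω) : dist x y ≤ (intrinsicDist Ω x y).toReal := by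
  rw [dist_edist]
  exact ENNReal.toReal_mono (intrinsicDist_ne_top hO hC hx hy) (edist_le_intrinsicDist x y)

/-- The intrinsic distance to a point agrees with the Euclidean one on small scales. -/
theorem abs_toReal_intrinsicDist_sub_le (hO : IsOpen Ω) (hC : IsPreconnected Ω)
    {x y z w : Euc n} {ρ : ℝ} (hx : x ∈ Ω) (h : ball w ρ ⊆ Ω) (hy : y ∈ ball w ρ)
    (hz : z ∈ ball w ρ) :
    |(intrinsicDist Ω x y).toReal - (intrinsicDist Ω x z).toReal| ≤ dist y z := by
  have hyz : (intrinsicDist Ω y z).toReal ≤ dist y z := by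
    rw [dist_edist]
    exact ENNReal.toReal_mono (edist_ne_top y z) (intrinsicDist_le_edist_of_ball_subset h hy hz)
  have h₁ := toReal_intrinsicDist_triangle hO hC hx (h hy) (h hz)
  have h₂ := toReal_intrinsicDist_triangle hO hC hx (h hz) (h hy)
  rw [intrinsicDist_comm z y] at h₂
  rw [abs_le]
  constructor <;> linarith

theorem continuousOn_toReal_intrinsicDist (hO : IsOpen Ω) (hC : IsPreconnected Ω) {x : Euc n}
    (hx : x ∈ Ω) : ContinuousOn (fun z => (intrinsicDist Ω x z).toReal) Ω := by
  refine Metric.continuousOn_iff.2 fun z hz ε hε => ?_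
  obtain ⟨ρ, hρ, hb⟩ := Metric.isOpen_iff.1 hO z hz
  refine ⟨min ρ ε, lt_min hρ hε, fun w _ hwz => ?_⟩
  exact (abs_toReal_intrinsicDist_sub_le hO hC hx hb (hwz.trans_le (min_le_left _ _))
    (mem_ball_self hρ)).trans_lt (hwz.trans_le (min_le_right _ _))

theorem mem_intrinsicBall_iff (hO : IsOpen Ω) (hC : IsPreconnected Ω) {x y : Euc n} {r : ℝ}
    (hx : x ∈ Ω) : y ∈ intrinsicBall Ω x r ↔ y ∈ Ω ∧ (intrinsicDist Ω x y).toReal < r :=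
  and_congr_right fun hy => ENNReal.lt_ofReal_iff_toReal_lt (intrinsicDist_ne_top hO hC hx hy)

theorem isOpen_intrinsicBall (hO : IsOpen Ω) (hC : IsPreconnected Ω) {x : Euc n} (hx : x ∈ Ω)
    (r : ℝ) : IsOpen (intrinsicBall Ω x r) := by
  convert (continuousOn_toReal_intrinsicDist hO hC hx).isOpen_inter_preimage hO (isOpen_Iio (a := r))
    using 1
  ext y
  exact mem_intrinsicBall_iff hO hC hx

theorem intrinsicBall_subset_ball (x : Euc n) (r : ℝ) : intrinsicBall Ω x r ⊆ ball x r := by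
  intro y hy
  have := (edist_le_intrinsicDist (Ω := Ω) x y).trans_lt hy.2
  rw [edist_dist, ENNReal.ofReal_lt_ofReal_iff_of_nonneg dist_nonneg] at this
  rwa [mem_ball']

theorem intrinsicBall_subset_ball_two_mul {x y : Euc n} {r : ℝ} (h : dist x y ≤ r) :
    intrinsicBall Ω y r ⊆ ball x (2 * r) ∩ Ω := by
  refine fun z hz => ⟨?_, hz.1⟩
  exact (intrinsicBall_subset_ball y r).trans
    (ball_subset_ball' (by rw [dist_comm]; linarith)) hz

theorem ball_subset_intrinsicBall {x : Euc n} {r : ℝ} (h : ball x r ⊆ Ω) :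
    ball x r ⊆ intrinsicBall Ω x r := by
  intro y hy
  refine ⟨h hy, (intrinsicDist_le_edist_of_ball_subset h (mem_ball_self (pos_of_mem_ball hy))
    hy).trans_lt ?_⟩
  rw [edist_dist, ENNReal.ofReal_lt_ofReal_iff_of_nonneg dist_nonneg]
  exact mem_ball'.1 hy

theorem volume_intrinsicBall_lt_top (x : Euc n) (r : ℝ) :
    volume (intrinsicBall Ω x r) < ⊤ :=
  (measure_mono (intrinsicBall_subset_ball x r)).trans_lt measure_ball_lt_top

theorem disjoint_intrinsicBall (hO : IsOpen Ω) (hC : IsPreconnected Ω) {x y : Euc n} {r s : ℝ}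
    (hx : x ∈ Ω) (hy : y ∈ Ω) (h : r + s ≤ (intrinsicDist Ω x y).toReal) :
    Disjoint (intrinsicBall Ω x r) (intrinsicBall Ω y s) := by
  refine disjoint_left.2 fun z hz₁ hz₂ => ?_
  rw [mem_intrinsicBall_iff hO hC hx] at hz₁
  rw [mem_intrinsicBall_iff hO hC hy, intrinsicDist_comm] at hz₂
  linarith [toReal_intrinsicDist_triangle hO hC hx hz₁.1 hy]

end IntrinsicMetric

section Capacity

variable {n : ℕ} {Ω : Set (Euc n)} {p C lam : ℝ}

/-- The local Sobolev–Poincaré imbedding inequality of order `p` with given constants. -/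
def LocalSPLowWith (n : ℕ) (Ω : Set (Euc n)) (p C lam : ℝ) : Prop :=
  ∀ u : Euc n → ℝ, LocallyLipschitzOnSet u Ω →
    ∀ x ∈ Ω, ∀ r : ℝ, 0 < r → r < diam Ω →
      (⨅ c : ℝ, (∫⁻ y in ball x r ∩ Ω,
          ENNReal.ofReal |u y - c| ^ ((n : ℝ) * p / ((n : ℝ) - p)) ∂volume)
            ^ (((n : ℝ) - p) / ((n : ℝ) * p)))
        ≤ ENNReal.ofReal C *
          (∫⁻ y in ball x (lam * r) ∩ Ω,
            ENNReal.ofReal ‖fderiv ℝ u y‖ ^ p ∂volume) ^ (1 / p)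

/-- The function equal to `1` on the intrinsic ball of radius `a`, to `0` off the intrinsic ball of
radius `b`, and affine in the intrinsic distance to `x` in between. -/
def intrinsicCutoff (Ω : Set (Euc n)) (x : Euc n) (a b : ℝ) (z : Euc n) : ℝ :=
  max 0 (min 1 ((b - (intrinsicDist Ω x z).toReal) / (b - a)))

theorem intrinsicCutoff_nonneg (x : Euc n) (a b : ℝ) (z : Euc n) :
    0 ≤ intrinsicCutoff Ω x a b z := le_max_left _ _

theorem intrinsicCutoff_eq_one {x z : Euc n} {a b : ℝ} (hab : a < b)
    (hz : (intrinsicDist Ω x z).toReal ≤ a) : intrinsicCutoff Ω x a b z = 1 := by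
  have : 1 ≤ (b - (intrinsicDist Ω x z).toReal) / (b - a) := by
    rw [one_le_div (sub_pos.2 hab)]
    linarith
  rw [intrinsicCutoff, min_eq_left this, max_eq_right zero_le_one]

theorem intrinsicCutoff_eq_zero {x z : Euc n} {a b : ℝ} (hab : a < b)
    (hz : b ≤ (intrinsicDist Ω x z).toReal) : intrinsicCutoff Ω x a b z = 0 := by
  have : (b - (intrinsicDist Ω x z).toReal) / (b - a) ≤ 0 :=
    div_nonpos_of_nonpos_of_nonneg (by linarith) (sub_pos.2 hab).le
  exact max_eq_left ((min_le_right _ _).trans this)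

theorem lipschitzOnWith_intrinsicCutoff (hO : IsOpen Ω) (hC : IsPreconnected Ω)
    {x w : Euc n} {a b ρ : ℝ} (hx : x ∈ Ω) (hab : a < b) (h : ball w ρ ⊆ Ω) :
    LipschitzOnWith (Real.toNNReal (1 / (b - a))) (intrinsicCutoff Ω x a b) (ball w ρ) := by
  have hba : 0 < b - a := sub_pos.2 hab
  have hclamp : LipschitzWith 1 fun s : ℝ => max 0 (min 1 s) :=
    (LipschitzWith.id.const_min 1).const_max 0
  refine LipschitzOnWith.of_dist_le_mul fun y hy z hz => ?_
  rw [Real.coe_toNNReal _ (by positivity)]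
  refine (hclamp.dist_le_mul _ _).trans ?_
  rw [NNReal.coe_one, one_mul, Real.dist_eq, div_sub_div_same,
    _root_.sub_sub_sub_cancel_left, abs_div, abs_of_pos hba, abs_sub_comm,
    div_eq_mul_one_div, mul_comm]
  gcongr
  exact abs_toReal_intrinsicDist_sub_le hO hC hx h hy hz

theorem locallyLipschitzOnSet_intrinsicCutoff (hO : IsOpen Ω) (hC : IsPreconnected Ω)
    {x : Euc n} {a b : ℝ} (hx : x ∈ Ω) (hab : a < b) :
    LocallyLipschitzOnSet (intrinsicCutoff Ω x a b) Ω := by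
  intro w hw
  obtain ⟨ρ, hρ, hb⟩ := Metric.isOpen_iff.1 hO w hw
  exact ⟨_, ball w ρ, mem_nhdsWithin_of_mem_nhds (ball_mem_nhds w hρ),
    lipschitzOnWith_intrinsicCutoff hO hC hx hab hb⟩

theorem norm_fderiv_intrinsicCutoff_le (hO : IsOpen Ω) (hC : IsPreconnected Ω)
    {x w : Euc n} {a b : ℝ} (hx : x ∈ Ω) (hw : w ∈ Ω) (hab : a < b) :
    ‖fderiv ℝ (intrinsicCutoff Ω x a b) w‖ ≤ 1 / (b - a) := by
  obtain ⟨ρ, hρ, hb⟩ := Metric.isOpen_iff.1 hO w hw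
  have := norm_fderiv_le_of_lipschitzOn ℝ (ball_mem_nhds w hρ)
    (lipschitzOnWith_intrinsicCutoff hO hC hx hab hb)
  rwa [Real.coe_toNNReal _ (one_div_nonneg.2 (sub_pos.2 hab).le)] at this

theorem fderiv_intrinsicCutoff_eq_zero {x w : Euc n} {a b : ℝ} (hab : a < b)
    (hw : b ≤ (intrinsicDist Ω x w).toReal) : fderiv ℝ (intrinsicCutoff Ω x a b) w = 0 := by
  refine IsLocalMin.fderiv_eq_zero (Filter.Eventually.of_forall fun z => ?_)
  rw [intrinsicCutoff_eq_zero hab hw]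
  exact intrinsicCutoff_nonneg x a b z

theorem lintegral_fderiv_intrinsicCutoff_le (hO : IsOpen Ω) (hC : IsPreconnected Ω)
    {x : Euc n} {a b : ℝ} (hx : x ∈ Ω) (hab : a < b) (hp : 0 < p) {S : Set (Euc n)}
    (hS : MeasurableSet S) :
    ∫⁻ y in S ∩ Ω, ENNReal.ofReal ‖fderiv ℝ (intrinsicCutoff Ω x a b) y‖ ^ p ≤
      ENNReal.ofReal (1 / (b - a)) ^ p * volume (intrinsicBall Ω x b ∩ S) := by
  have hE := (isOpen_intrinsicBall hO hC hx b).measurableSet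
  calc _ ≤ ∫⁻ y in S ∩ Ω, (intrinsicBall Ω x b).indicator
        (fun _ => ENNReal.ofReal (1 / (b - a)) ^ p) y := by
        refine setLIntegral_mono' (hS.inter hO.measurableSet) fun y hy => ?_
        by_cases hyE : y ∈ intrinsicBall Ω x b
        · rw [indicator_of_mem hyE]
          gcongr
          exact norm_fderiv_intrinsicCutoff_le hO hC hx hy.2 hab
        · rw [indicator_of_notMem hyE]
          rw [mem_intrinsicBall_iff hO hC hx, not_and, not_lt] at hyE
          simp [fderiv_intrinsicCutoff_eq_zero hab (hyE hy.2), hp]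
    _ = ENNReal.ofReal (1 / (b - a)) ^ p * volume (intrinsicBall Ω x b ∩ (S ∩ Ω)) := by
        rw [lintegral_indicator_const hE, Measure.restrict_apply hE]
    _ ≤ _ := by gcongr; exact inter_subset_left

theorem half_rpow_mul_le_lintegral_sub_const {u : Euc n → ℝ} {A B S : Set (Euc n)} {q : ℝ}
    (hq : 0 < q) (hA : MeasurableSet A) (hB : MeasurableSet B) (hAS : A ⊆ S) (hBS : B ⊆ S)
    (huA : ∀ y ∈ A, u y = 1) (huB : ∀ y ∈ B, u y = 0) {m : ℝ≥0∞} (hmA : m ≤ volume A)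
    (hmB : m ≤ volume B) (c : ℝ) :
    ENNReal.ofReal (1 / 2) ^ q * m ≤ ∫⁻ y in S, ENNReal.ofReal |u y - c| ^ q := by
  have key : ∀ D : Set (Euc n), MeasurableSet D → D ⊆ S → m ≤ volume D →
      (∀ y ∈ D, 1 / 2 ≤ |u y - c|) →
      ENNReal.ofReal (1 / 2) ^ q * m ≤ ∫⁻ y in S, ENNReal.ofReal |u y - c| ^ q := by
    intro D hD hDS hmD hu
    calc ENNReal.ofReal (1 / 2) ^ q * m ≤ ENNReal.ofReal (1 / 2) ^ q * volume D := by gcongr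
      _ = ∫⁻ _ in D, ENNReal.ofReal (1 / 2) ^ q := by rw [setLIntegral_const]
      _ ≤ ∫⁻ y in D, ENNReal.ofReal |u y - c| ^ q :=
          setLIntegral_mono' hD fun y hy => by gcongr; exact hu y hy
      _ ≤ _ := lintegral_mono_set hDS
  rcases le_total c (1 / 2) with hc | hc
  · refine key A hA hAS hmA fun y hy => ?_
    rw [huA y hy]
    exact le_trans (by linarith) (le_abs_self _)
  · refine key B hB hBS hmB fun y hy => ?_
    rw [huB y hy]
    exact le_trans (by linarith) (neg_le_abs _)

/-- The radius, up to a dimensional factor, of a ball with the same volume as `s`. -/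
def volRadius {n : ℕ} (s : Set (Euc n)) : ℝ := volume.real s ^ (1 / (n : ℝ))

theorem volRadius_nonneg (s : Set (Euc n)) : 0 ≤ volRadius s :=
  Real.rpow_nonneg measureReal_nonneg _

theorem volRadius_mono {s t : Set (Euc n)} (h : s ⊆ t) (ht : volume t < ⊤) :
    volRadius s ≤ volRadius t :=
  Real.rpow_le_rpow measureReal_nonneg (measureReal_mono h ht.ne) (by positivity)

theorem volRadius_rpow (s : Set (Euc n)) (β : ℝ) :
    volume.real s ^ (β / n) = volRadius s ^ β := by
  rw [volRadius, ← Real.rpow_mul measureReal_nonneg, one_div_mul_eq_div]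

theorem volRadius_ball (hn : n ≠ 0) (x : Euc n) {r : ℝ} (hr : 0 < r) :
    volRadius (ball x r) = r * volRadius (ball (0 : Euc n) 1) := by
  have : volume.real (ball x r) = r ^ n * volume.real (ball (0 : Euc n) 1) := by
    rw [measureReal_def, Measure.addHaar_ball_of_pos _ _ hr, ENNReal.toReal_mul,
      ENNReal.toReal_ofReal (by positivity), finrank_euclideanSpace_fin, measureReal_def]
  rw [volRadius, this, Real.mul_rpow (by positivity) measureReal_nonneg, one_div,
    Real.pow_rpow_inv_natCast hr.le hn, volRadius, one_div]

theorem volRadius_ball_pos (x : Euc n) {r : ℝ} (hr : 0 < r) : 0 < volRadius (ball x r) :=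
  Real.rpow_pos_of_pos (ENNReal.toReal_pos (measure_ball_pos volume x hr).ne'
    measure_ball_lt_top.ne) _

theorem LocalSPLowWith.capacity_le (h : LocalSPLowWith n Ω p C lam) (hC : 0 ≤ C) (hp : 1 ≤ p)
    (hpn : p < n) (hO : IsOpen Ω) (hconn : IsPreconnected Ω) {x : Euc n} (hx : x ∈ Ω)
    {a b R m : ℝ} (hab : a < b) (haR : a ≤ R) (hR : 0 < R) (hRd : R < diam Ω)
    {B : Set (Euc n)} (hB : MeasurableSet B) (hBR : B ⊆ ball x R ∩ Ω)
    (hdisj : Disjoint (intrinsicBall Ω x b) B) (hm : 0 ≤ m)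
    (hmA : m ≤ volRadius (intrinsicBall Ω x a)) (hmB : m ≤ volRadius B) :
    1 / 2 * m ^ ((n : ℝ) / p - 1) ≤ C / (b - a) *
      volRadius (intrinsicBall Ω x b ∩ ball x (lam * R)) ^ ((n : ℝ) / p) := by
  have hp0 : 0 < p := by linarith
  have hn0 : (0 : ℝ) < n := by linarith
  have hnp : 0 < (n : ℝ) - p := by linarith
  have hn : n ≠ 0 := by exact_mod_cast hn0.ne'
  have hba : 0 < b - a := sub_pos.2 hab
  have hvol : ∀ s : Set (Euc n), m ≤ volRadius s → ENNReal.ofReal (m ^ n) ≤ volume s := by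
    intro s hs
    refine ENNReal.ofReal_le_of_le_toReal ?_
    calc m ^ n ≤ volRadius s ^ n := by gcongr
      _ = volume.real s := by
        rw [volRadius, one_div, Real.rpow_inv_natCast_pow measureReal_nonneg hn]
  set q : ℝ := (n : ℝ) * p / ((n : ℝ) - p) with hq
  have hq0 : 0 < q := by positivity
  have hqinv : ((n : ℝ) - p) / ((n : ℝ) * p) = q⁻¹ := by rw [hq, inv_div]
  set E := intrinsicBall Ω x b ∩ ball x (lam * R) with hE
  have hEfin : volume E ≠ ⊤ :=
    ((measure_mono inter_subset_left).trans_lt (volume_intrinsicBall_lt_top x b)).ne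
  have hsp := h (intrinsicCutoff Ω x a b) (locallyLipschitzOnSet_intrinsicCutoff hO hconn hx hab)
    x hx R hR hRd
  have hlow : ENNReal.ofReal (1 / 2 * m ^ ((n : ℝ) / p - 1)) ≤
      ⨅ c : ℝ, (∫⁻ y in ball x R ∩ Ω, ENNReal.ofReal |intrinsicCutoff Ω x a b y - c| ^ q)
        ^ (((n : ℝ) - p) / ((n : ℝ) * p)) := by
    refine le_iInf fun c => ?_
    have hexp : m ^ ((n : ℝ) / p - 1) = (m ^ n) ^ q⁻¹ := by
      rw [← Real.rpow_natCast, ← Real.rpow_mul hm, ← hqinv]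
      congr 1
      field_simp
    calc ENNReal.ofReal (1 / 2 * m ^ ((n : ℝ) / p - 1))
        = (ENNReal.ofReal (1 / 2) ^ q * ENNReal.ofReal (m ^ n)) ^ q⁻¹ := by
          rw [ENNReal.mul_rpow_of_nonneg _ _ (by positivity), ENNReal.rpow_rpow_inv hq0.ne',
            ENNReal.ofReal_rpow_of_nonneg (by positivity) (by positivity),
            ← ENNReal.ofReal_mul (by positivity), hexp]
      _ ≤ _ := by
          rw [hqinv]
          gcongr
          have hAR : intrinsicBall Ω x a ⊆ ball x R ∩ Ω := fun y hy =>
            ⟨ball_subset_ball haR (intrinsicBall_subset_ball x a hy), hy.1⟩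
          refine half_rpow_mul_le_lintegral_sub_const hq0
            (isOpen_intrinsicBall hO hconn hx a).measurableSet hB hAR hBR
            (fun y hy => intrinsicCutoff_eq_one hab ?_) (fun y hy => intrinsicCutoff_eq_zero hab ?_)
            (hvol _ hmA) (hvol _ hmB) c
          · exact ((mem_intrinsicBall_iff hO hconn hx).1 hy).2.le
          · have hyE := disjoint_right.1 hdisj hy
            rw [mem_intrinsicBall_iff hO hconn hx, not_and, not_lt] at hyE
            exact hyE (hBR hy).2
  have hup : ENNReal.ofReal C * (∫⁻ y in ball x (lam * R) ∩ Ω,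
      ENNReal.ofReal ‖fderiv ℝ (intrinsicCutoff Ω x a b) y‖ ^ p) ^ (1 / p) ≤
      ENNReal.ofReal (C / (b - a) * volRadius E ^ ((n : ℝ) / p)) := by
    calc _ ≤ ENNReal.ofReal C * (ENNReal.ofReal (1 / (b - a)) ^ p * volume E) ^ (1 / p) := by
          gcongr
          exact lintegral_fderiv_intrinsicCutoff_le hO hconn hx hab hp0 measurableSet_ball
      _ = _ := by
          rw [ENNReal.mul_rpow_of_nonneg _ _ (by positivity), one_div p,
            ENNReal.rpow_rpow_inv hp0.ne', ← ENNReal.ofReal_toReal hEfin,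
            ENNReal.ofReal_rpow_of_nonneg ENNReal.toReal_nonneg (by positivity),
            ← ENNReal.ofReal_mul (by positivity), ← ENNReal.ofReal_mul hC, ← volRadius_rpow,
            measureReal_def, div_div_cancel_left' hn0.ne']
          congr 1
          ring
  have hfinal := hlow.trans (hsp.trans hup)
  rwa [ENNReal.ofReal_le_ofReal_iff
    (mul_nonneg (by positivity) (Real.rpow_nonneg (volRadius_nonneg _) _))] at hfinal

end Capacity

section Quasiconvexity

/-- A nonlinear self-improving decay estimate forces a linear lower bound for a function which is
at least linear near `0`. -/
theorem mul_le_of_rpow_half_le {g : ℝ → ℝ} {β A δ ω r : ℝ} (hg : ∀ t, 0 ≤ g t) (hβ : 0 < β)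
    (hA : 0 < A) (hr : 0 < r) (hω : 0 < ω) (hδ : A * δ = (1 / 4) ^ β)
    (hsmall : ∃ ρ > 0, ∀ t, 0 < t → t ≤ ρ → ω * t ≤ g t)
    (hstep : ∀ t, 0 < t → t ≤ r → g (t / 2) ^ β ≤ A / t * g t ^ (β + 1)) :
    δ * r ≤ g r := by
  by_contra! hlt
  have hδ0 : 0 < δ := pos_of_mul_pos_right (hδ ▸ by positivity) hA.le
  have hdecay : ∀ k : ℕ, g (r / 2 ^ k) ≤ δ * r / 4 ^ k := by
    intro k
    induction k with
    | zero => simpa using hlt.le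
    | succ k ih =>
      have ht : 0 < r / 2 ^ k := by positivity
      have htr : r / 2 ^ k ≤ r := div_le_self hr.le (one_le_pow₀ one_le_two)
      have hgt : g (r / 2 ^ k) ≤ δ * (r / 2 ^ k) := by
        refine ih.trans ?_
        rw [mul_div_assoc]
        gcongr
        norm_num
      have hrpow : g (r / 2 ^ k / 2) ^ β ≤ (g (r / 2 ^ k) / 4) ^ β := by
        calc g (r / 2 ^ k / 2) ^ β ≤ A / (r / 2 ^ k) * g (r / 2 ^ k) ^ (β + 1) := hstep _ ht htr
          _ = A / (r / 2 ^ k) * g (r / 2 ^ k) * g (r / 2 ^ k) ^ β := by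
              rw [Real.rpow_add_one' (hg _) (by positivity)]
              ring
          _ ≤ A / (r / 2 ^ k) * (δ * (r / 2 ^ k)) * g (r / 2 ^ k) ^ β := by
              have := Real.rpow_nonneg (hg (r / 2 ^ k)) β
              gcongr
          _ = A * δ * g (r / 2 ^ k) ^ β := by
              field_simp
          _ = (g (r / 2 ^ k) / 4) ^ β := by
              rw [hδ, ← Real.mul_rpow (by norm_num) (hg _), one_div_mul_eq_div]
      have hle := (Real.rpow_le_rpow_iff (hg _) (div_nonneg (hg _) (by norm_num)) hβ).1 hrpow
      calc g (r / 2 ^ (k + 1)) = g (r / 2 ^ k / 2) := by rw [pow_succ, div_div]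
        _ ≤ g (r / 2 ^ k) / 4 := hle
        _ ≤ δ * r / 4 ^ k / 4 := by gcongr
        _ = δ * r / 4 ^ (k + 1) := by rw [pow_succ, div_div]
  obtain ⟨ρ, hρ, hρg⟩ := hsmall
  obtain ⟨k, hk⟩ := pow_unbounded_of_one_lt (max (δ / ω) (r / ρ)) (one_lt_two (α := ℝ))
  have h₁ : δ < 2 ^ k * ω := (div_lt_iff₀ hω).1 ((le_max_left _ _).trans_lt hk)
  have h₂ : r < 2 ^ k * ρ := (div_lt_iff₀ hρ).1 ((le_max_right _ _).trans_lt hk)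
  have h₃ := (hρg (r / 2 ^ k) (by positivity)
    ((div_le_iff₀ (by positivity)).2 (by linarith))).trans (hdecay k)
  have h₄ : (4 : ℝ) ^ k = 2 ^ k * 2 ^ k := by rw [← mul_pow]; norm_num
  rw [h₄, ← mul_div_assoc, div_le_div_iff₀ (by positivity) (by positivity)] at h₃
  have : 0 < (2 ^ k * ω - δ) * (r * 2 ^ k) := mul_pos (sub_pos.2 h₁) (by positivity)
  linarith

variable {n : ℕ} {Ω : Set (Euc n)} {p C lam : ℝ}

theorem LocalSPLowWith.mul_le_volRadius_intrinsicBall (h : LocalSPLowWith n Ω p C lam)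
    (hC : 0 < C) (hp : 1 ≤ p) (hpn : p < n) (hO : IsOpen Ω) (hconn : IsPreconnected Ω)
    {x y : Euc n} (hx : x ∈ Ω) (hy : y ∈ Ω) {r : ℝ} (hr : 0 < r) (hrd : 2 * r < diam Ω)
    (hxy : dist x y ≤ r) (hd : 2 * r ≤ (intrinsicDist Ω x y).toReal)
    (hle : volRadius (intrinsicBall Ω x r) ≤ volRadius (intrinsicBall Ω y r)) :
    (1 / 4) ^ ((n : ℝ) / p - 1) / (4 * C) * r ≤ volRadius (intrinsicBall Ω x r) := by
  have hβ : 0 < (n : ℝ) / p - 1 := sub_pos.2 ((one_lt_div (by linarith)).2 hpn)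
  have hn : n ≠ 0 := by
    rintro rfl
    norm_num at hpn
    linarith
  have hball : ∀ t, volume (intrinsicBall Ω x t) < ⊤ := volume_intrinsicBall_lt_top x
  refine mul_le_of_rpow_half_le (g := fun t => volRadius (intrinsicBall Ω x t)) (A := 4 * C)
    (fun t => volRadius_nonneg _) hβ (by positivity) hr (volRadius_ball_pos (0 : Euc n) one_pos)
    (by field_simp) ?_ fun t ht htr => ?_
  · obtain ⟨ρ, hρ, hb⟩ := Metric.isOpen_iff.1 hO x hx
    refine ⟨ρ, hρ, fun t ht htρ => ?_⟩
    rw [mul_comm, ← volRadius_ball hn x ht]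
    exact volRadius_mono (ball_subset_intrinsicBall ((ball_subset_ball htρ).trans hb)) (hball t)
  · have hhalf : volRadius (intrinsicBall Ω x (t / 2)) ≤ volRadius (intrinsicBall Ω x r) :=
      volRadius_mono (fun z hz => ⟨hz.1, hz.2.trans_le (ENNReal.ofReal_le_ofReal (by linarith))⟩)
        (hball r)
    have hcap := h.capacity_le hC.le hp hpn hO hconn hx (a := t / 2) (b := t) (R := 2 * r)
      (m := volRadius (intrinsicBall Ω x (t / 2))) (B := intrinsicBall Ω y r) (by linarith)
      (by linarith) (by linarith) hrd (isOpen_intrinsicBall hO hconn hy r).measurableSet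
      (intrinsicBall_subset_ball_two_mul hxy)
      (disjoint_intrinsicBall hO hconn hx hy (by linarith)) (volRadius_nonneg _) le_rfl
      (hhalf.trans hle)
    have hE : volRadius (intrinsicBall Ω x t ∩ ball x (lam * (2 * r))) ^ ((n : ℝ) / p) ≤
        volRadius (intrinsicBall Ω x t) ^ ((n : ℝ) / p) :=
      Real.rpow_le_rpow (volRadius_nonneg _) (volRadius_mono inter_subset_left (hball t))
        (by linarith)
    simp only [sub_add_cancel]
    calc volRadius (intrinsicBall Ω x (t / 2)) ^ ((n : ℝ) / p - 1)
        ≤ 2 * (C / (t - t / 2) *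
          volRadius (intrinsicBall Ω x t ∩ ball x (lam * (2 * r))) ^ ((n : ℝ) / p)) := by linarith
      _ ≤ 2 * (C / (t - t / 2) * volRadius (intrinsicBall Ω x t) ^ ((n : ℝ) / p)) := by
        have : 0 < t - t / 2 := by linarith
        gcongr
      _ = 4 * C / t * volRadius (intrinsicBall Ω x t) ^ ((n : ℝ) / p) := by
        rw [_root_.sub_half]
        field_simp
        ring

/-- The intrinsic distance is comparable to the Euclidean one at scales below half the diameter. -/
theorem LocalSPLowWith.exists_intrinsicDist_le (h : LocalSPLowWith n Ω p C lam)
    (hC : 0 < C) (hlam : 1 ≤ lam) (hp : 1 ≤ p) (hpn : p < n) (hO : IsOpen Ω)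
    (hconn : IsPreconnected Ω) :
    ∃ M : ℝ, 0 < M ∧ ∀ x ∈ Ω, ∀ y ∈ Ω, 2 * dist x y < diam Ω →
      (intrinsicDist Ω x y).toReal ≤ M * dist x y := by
  have hβ : 0 < (n : ℝ) / p - 1 := sub_pos.2 ((one_lt_div (by linarith)).2 hpn)
  have hn : n ≠ 0 := by
    rintro rfl
    norm_num at hpn
    linarith
  set β := (n : ℝ) / p - 1 with hβdef
  have hβ1 : (n : ℝ) / p = β + 1 := by ring
  set δ : ℝ := (1 / 4) ^ β / (4 * C) with hδ
  have hδ0 : 0 < δ := by positivity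
  set ω := volRadius (ball (0 : Euc n) 1) with hω
  have hω0 : 0 < ω := volRadius_ball_pos 0 one_pos
  set N : ℝ := 2 * C * (lam * 2 * ω) ^ (β + 1) / δ ^ β with hN
  have hN0 : 0 < N := by positivity
  refine ⟨4 + N, by linarith, fun x hx y hy hxy => ?_⟩
  wlog hle : volRadius (intrinsicBall Ω x (dist x y)) ≤ volRadius (intrinsicBall Ω y (dist x y))
    generalizing x y
  · rw [intrinsicDist_comm, dist_comm]
    rw [dist_comm] at hle hxy
    exact this y hy x hx hxy (le_of_not_ge hle)
  rcases eq_or_ne x y with rfl | hne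
  · simp [intrinsicDist_self hx]
  have hr : 0 < dist x y := dist_pos.2 hne
  generalize hrdef : dist x y = r at hr hxy hle ⊢
  generalize hddef : (intrinsicDist Ω x y).toReal = d
  by_contra! hlt
  have hd4 : 4 * r < d := by nlinarith
  have hlow : δ * r ≤ volRadius (intrinsicBall Ω x r) :=
    h.mul_le_volRadius_intrinsicBall hC hp hpn hO hconn hx hy hr hxy hrdef.le
      (by linarith) hle
  have hcap := h.capacity_le hC.le hp hpn hO hconn hx (a := r) (b := d - r) (R := 2 * r)
    (m := δ * r) (B := intrinsicBall Ω y r) (by linarith) (by linarith) (by linarith) hxy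
    (isOpen_intrinsicBall hO hconn hy r).measurableSet
    (intrinsicBall_subset_ball_two_mul hrdef.le)
    (disjoint_intrinsicBall hO hconn hx hy (by linarith)) (by positivity) hlow (hlow.trans hle)
  have hE : volRadius (intrinsicBall Ω x (d - r) ∩ ball x (lam * (2 * r))) ≤ lam * 2 * ω * r := by
    refine (volRadius_mono inter_subset_right measure_ball_lt_top).trans_eq ?_
    rw [volRadius_ball hn x (by positivity)]
    ring
  have hgap : 0 < d - r - r := by linarith
  rw [← hβdef, hβ1] at hcap
  have hmain : 1 / 2 * (δ * r) ^ β ≤ C / (d - r - r) * (lam * 2 * ω * r) ^ (β + 1) := by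
    refine hcap.trans ?_
    have := volRadius_nonneg (intrinsicBall Ω x (d - r) ∩ ball x (lam * (2 * r)))
    gcongr
  rw [Real.mul_rpow hδ0.le hr.le, Real.mul_rpow (by positivity) hr.le,
    Real.rpow_add_one hr.ne', div_mul_eq_mul_div C, le_div_iff₀ hgap] at hmain
  have hrβ : 0 < r ^ β := by positivity
  have hδβ : 0 < δ ^ β := by positivity
  have hdle : d - r - r ≤ N * r := by
    rw [hN, div_mul_eq_mul_div, le_div_iff₀ hδβ]
    refine le_of_mul_le_mul_right ?_ hrβ
    linarith
  linarith

/-- The intrinsic distance of a totally bounded domain is bounded as soon as it is bounded at some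
fixed Euclidean scale. -/
theorem exists_intrinsicDist_le_of_totallyBounded (hO : IsOpen Ω) (hconn : IsPreconnected Ω)
    (hbdd : TotallyBounded Ω) {ε K : ℝ} (hε : 0 < ε)
    (hloc : ∀ x ∈ Ω, ∀ y ∈ Ω, dist x y < ε → (intrinsicDist Ω x y).toReal ≤ K) :
    ∃ D : ℝ, ∀ x ∈ Ω, ∀ y ∈ Ω, (intrinsicDist Ω x y).toReal ≤ D := by
  obtain ⟨t, htΩ, htfin, htcov⟩ := Metric.finite_approx_of_totallyBounded hbdd ε hε
  obtain ⟨D, hD⟩ := ((htfin.prod htfin).image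
    fun z : Euc n × Euc n => (intrinsicDist Ω z.1 z.2).toReal).bddAbove
  have hnet : ∀ x ∈ Ω, ∃ z ∈ t, dist x z < ε := fun x hx => by
    simpa using htcov hx
  refine ⟨K + D + K, fun x hx y hy => ?_⟩
  obtain ⟨z, hz, hxz⟩ := hnet x hx
  obtain ⟨w, hw, hyw⟩ := hnet y hy
  have h₁ := toReal_intrinsicDist_triangle hO hconn hx (htΩ hz) hy
  have h₂ := toReal_intrinsicDist_triangle hO hconn (htΩ hz) (htΩ hw) hy
  have h₃ := hloc x hx z (htΩ hz) hxz
  have h₄ := hloc w (htΩ hw) y hy (by rwa [dist_comm])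
  have h₅ : (intrinsicDist Ω z w).toReal ≤ D := hD ⟨(z, w), ⟨hz, hw⟩, rfl⟩
  linarith

theorem isQuasiconvex_of_intrinsicDist_le (hO : IsOpen Ω) (hconn : IsPreconnected Ω) {K : ℝ}
    (hK : ∀ x ∈ Ω, ∀ y ∈ Ω, (intrinsicDist Ω x y).toReal ≤ K * dist x y) :
    IsQuasiconvex Ω := by
  refine ⟨max 1 (K + 1), le_max_left _ _, fun x hx y hy => ?_⟩
  rcases eq_or_ne x y with rfl | hne
  · exact ⟨fun _ => x, continuousOn_const, rfl, rfl, fun _ _ => hx,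
      (eVariationOn.constant_on (by simp)).trans_le zero_le⟩
  · have hr : 0 < dist x y := dist_pos.2 hne
    have hlt : intrinsicDist Ω x y < ENNReal.ofReal ((K + 1) * dist x y) := by
      rw [ENNReal.lt_ofReal_iff_toReal_lt (intrinsicDist_ne_top hO hconn hx hy)]
      linarith [hK x hx y hy]
    obtain ⟨γ, hc, h0, h1, hm, hv⟩ := intrinsicDist_lt_iff.1 hlt
    refine ⟨γ, hc, h0, h1, hm, hv.le.trans (ENNReal.ofReal_le_ofReal ?_)⟩
    gcongr
    exact le_max_right _ _

end Quasiconvexity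

/-- a bounded local Sobolev–Poincaré imbedding domain of order
`p`, `1 ≤ p < n`, is quasiconvex. -/
theorem stmt16 (n : ℕ) (hn : 2 ≤ n) (p : ℝ) (hp1 : 1 ≤ p) (hpn : p < n)
    (Ω : Set (Euc n)) (hOpen : IsOpen Ω)
    (hConn : IsConnected Ω) (hBdd : Bornology.IsBounded Ω)
    (hSP : LocalSPLow n Ω p) :
    IsQuasiconvex Ω := by
  obtain ⟨C, hC, lam, hlam, hSP⟩ := hSP
  have hC0 : 0 < C := by linarith
  obtain ⟨M, hM, hloc⟩ := LocalSPLowWith.exists_intrinsicDist_le hSP hC0 hlam hp1 hpn hOpen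
    hConn.isPreconnected
  rcases (diam_nonneg (s := Ω)).eq_or_lt with hd | hd
  · refine isQuasiconvex_of_intrinsicDist_le hOpen hConn.isPreconnected (K := 0)
      fun x hx y hy => ?_
    have hxy : x = y := dist_le_zero.1 (hd ▸ dist_le_diam_of_mem hBdd hx hy)
    subst hxy
    simp [intrinsicDist_self hx]
  · obtain ⟨D, hD⟩ := exists_intrinsicDist_le_of_totallyBounded hOpen hConn.isPreconnected
      (hBdd.isCompact_closure.totallyBounded.subset subset_closure)
      (ε := diam Ω / 2) (K := M * (diam Ω / 2)) (by positivity)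
      fun x hx y hy hxy => (hloc x hx y hy (by linarith)).trans (by gcongr)
    refine isQuasiconvex_of_intrinsicDist_le hOpen hConn.isPreconnected
      (K := max M (2 * D / diam Ω)) fun x hx y hy => ?_
    rcases lt_or_ge (2 * dist x y) (diam Ω) with hxy | hxy
    · refine (hloc x hx y hy hxy).trans ?_
      gcongr
      exact le_max_left _ _
    · have hD0 : 0 ≤ D := ENNReal.toReal_nonneg.trans (hD x hx y hy)
      calc (intrinsicDist Ω x y).toReal ≤ D := hD x hx y hy
        _ = 2 * D / diam Ω * (diam Ω / 2) := by field_simp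
        _ ≤ max M (2 * D / diam Ω) * dist x y := by
          gcongr
          · exact le_max_right _ _
          · linarith
end
end
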